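/- For every ε > 0 there exists K(ε) > 0 such that the upper density with respect to ℙ_T of the set M_{K(ε)} = {γ ∈ SL(2,ℤ) : |Tr(γ)| > 2 and there exists a prime p ≥ K(ε) dividing m_γ} is at most ε; that is, limsup_{T→∞} |M_{K(ε)} ∩ Γ_T| / |Γ_T| ≤ ε. (For odd primes p, p divides m_γ if and only if p divides u_γ or p divides f_γ.) -/

import Mathlib

noncomputable section

open Matrix Filter Topology

/-- `Γ = SL(2,ℤ)`. -/
abbrev SL2Z := Matrix.SpecialLinearGroup (Fin 2) ℤ

/-- Frobenius norm of a matrix in `SL(2,ℤ)`. -/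
noncomputable def frobNorm (γ : SL2Z) : ℝ :=
  Real.sqrt ((γ 0 0 ^ 2 + γ 0 1 ^ 2 + γ 1 0 ^ 2 + γ 1 1 ^ 2 : ℤ) : ℝ)

/-- Trace of a matrix in `SL(2,ℤ)`. -/
def trZ (γ : SL2Z) : ℤ := γ 0 0 + γ 1 1

/-- `γ` is hyperbolic and the integer `m_γ` (defined by `Tr(γ)² - 4 = m_γ² D_γ` with
`m_γ ≥ 1`, `D_γ > 1` squarefree) has a prime factor `≥ K`. -/
def InMK (K : ℕ) (γ : SL2Z) : Prop :=
  2 < |trZ γ| ∧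
    ∃ mm D : ℤ, 1 ≤ mm ∧ 1 < D ∧ Squarefree D ∧
      (trZ γ) ^ 2 - 4 = mm ^ 2 * D ∧
      ∃ q : ℕ, q.Prime ∧ K ≤ q ∧ (q : ℤ) ∣ mm

open scoped ENNReal

/-- The indicator of a proposition, as an extended nonnegative real. -/
def ind (P : Prop) : ℝ≥0∞ := by
  classical exact if P then 1 else 0

lemma ind_of {P : Prop} (h : P) : ind P = 1 := by simp [ind, h]

lemma ind_of_not {P : Prop} (h : ¬P) : ind P = 0 := by simp [ind, h]

lemma ind_mono {P Q : Prop} (h : P → Q) : ind P ≤ ind Q := by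
  by_cases hP : P
  · rw [ind_of hP, ind_of (h hP)]
  · rw [ind_of_not hP]; exact zero_le

lemma ind_le_one (P : Prop) : ind P ≤ 1 := by
  by_cases hP : P
  · rw [ind_of hP]
  · rw [ind_of_not hP]; exact zero_le

lemma ind_congr {P Q : Prop} (h : P ↔ Q) : ind P = ind Q := by rw [propext h]

lemma ind_mul_ind (P Q : Prop) : ind P * ind Q = ind (P ∧ Q) := by
  by_cases hP : P <;> by_cases hQ : Q <;> simp [ind, hP, hQ]

lemma ind_mul_le_ind_mul {P : Prop} {a b : ℝ≥0∞} (h : P → a ≤ b) :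
    ind P * a ≤ ind P * b := by
  by_cases hP : P
  · exact mul_le_mul_right (h hP) _
  · simp [ind_of_not hP]

lemma ind_mul_le {P : Prop} {a b : ℝ≥0∞} (h : P → a ≤ b) : ind P * a ≤ b := by
  by_cases hP : P
  · rw [ind_of hP, one_mul]; exact h hP
  · simp [ind_of_not hP]

/-- Comparison of sums along a map that is injective on the support of the summand. -/
lemma tsum_ind_le_of_injOn {α β : Type*} {P : α → Prop} (F : α → β) (g : β → ℝ≥0∞)
    (f : α → ℝ≥0∞) (hF : ∀ x y, P x → P y → F x = F y → x = y)
    (hfg : ∀ x, P x → f x ≤ g (F x)) :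
    ∑' x, ind (P x) * f x ≤ ∑' y, g y := by
  have h1 : ∑' x, ind (P x) * f x = ∑' x : {x // P x}, f x := by
    rw [← tsum_subtype_eq_of_support_subset (s := {x | P x})]
    · exact tsum_congr fun x => by rw [ind_of (show P x from x.2), one_mul]
    · intro x hx
      by_contra hP
      exact hx (by simp [ind_of_not (show ¬P x from hP)])
  rw [h1]
  calc ∑' x : {x // P x}, f x ≤ ∑' x : {x // P x}, g (F x) :=
        ENNReal.tsum_le_tsum fun x => hfg x x.2
    _ ≤ ∑' y, g y := ENNReal.tsum_comp_le_tsum_of_injective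
        (f := fun x : {x // P x} => F x) (fun x y h => Subtype.ext (hF x y x.2 y.2 h)) g

lemma tsum_natAbs_le (f : ℕ → ℝ≥0∞) : ∑' t : ℤ, f t.natAbs ≤ 2 * ∑' n, f n := by
  have hinj : Function.Injective (fun t : ℤ => (decide (t < 0), t.natAbs)) := by
    intro s t h
    simp only [Prod.mk.injEq, decide_eq_decide] at h
    omega
  calc ∑' t : ℤ, f t.natAbs ≤ ∑' p : Bool × ℕ, f p.2 :=
        ENNReal.tsum_comp_le_tsum_of_injective hinj (fun p : Bool × ℕ => f p.2)
    _ = 2 * ∑' n, f n := by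
        rw [ENNReal.tsum_prod' (f := fun p : Bool × ℕ => f p.2), tsum_fintype]
        simp [two_mul]

lemma tsum_nat_ind_le_mul (x : ℝ) (f : ℕ → ℝ≥0∞) :
    ∑' n : ℕ, ind ((n : ℝ) ≤ x) * f n ≤ ∑ n ∈ Finset.range (⌊x⌋₊ + 1), f n := by
  rw [tsum_eq_sum (s := Finset.range (⌊x⌋₊ + 1))]
  · exact Finset.sum_le_sum fun n _ => ind_mul_le fun _ => le_rfl
  · intro n hn
    rw [ind_of_not, zero_mul]
    intro h
    exact hn (Finset.mem_range.2 (Nat.lt_succ_of_le (Nat.le_floor h)))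

lemma natAbs_cast_real (t : ℤ) : ((t.natAbs : ℕ) : ℝ) = |(t : ℝ)| := by
  rw [Nat.cast_natAbs, Int.cast_abs]

lemma tsum_int_abs_le {L : ℝ} (hL : 0 ≤ L) :
    ∑' t : ℤ, ind (|(t : ℝ)| ≤ L) ≤ ENNReal.ofReal (2 * L + 2) := by
  have h := tsum_natAbs_le (fun n => ind ((n : ℝ) ≤ L) * 1)
  simp only [natAbs_cast_real] at h
  simp only [mul_one] at h
  refine h.trans ?_
  have h2 := tsum_nat_ind_le_mul L (fun _ => 1)
  simp only [mul_one] at h2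
  calc 2 * ∑' n : ℕ, ind ((n : ℝ) ≤ L) ≤ 2 * ∑ n ∈ Finset.range (⌊L⌋₊ + 1), 1 := by gcongr
    _ = ENNReal.ofReal (2 * (⌊L⌋₊ + 1)) := by
        rw [ENNReal.ofReal_mul (by norm_num)]
        simp only [Finset.sum_const, Finset.card_range, nsmul_eq_mul, mul_one]
        norm_cast
    _ ≤ _ := ENNReal.ofReal_le_ofReal (by linarith [Nat.floor_le hL])

lemma sum_range_inv_sqrt_le (n : ℕ) :
    ∑ k ∈ Finset.range n, 1 / √((k : ℝ) + 1) ≤ 2 * √(n : ℝ) := by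
  induction n with
  | zero => simp
  | succ n ih =>
    rw [Finset.sum_range_succ]
    have h1 : 0 < √((n : ℝ) + 1) := Real.sqrt_pos.2 (by positivity)
    have h3 : 1 / √((n : ℝ) + 1) ≤ 2 * (√((n : ℝ) + 1) - √(n : ℝ)) := by
      rw [div_le_iff₀ h1]
      have e1 := Real.sq_sqrt (show (0 : ℝ) ≤ (n : ℝ) + 1 by positivity)
      have e2 := Real.sq_sqrt (show (0 : ℝ) ≤ (n : ℝ) by positivity)
      nlinarith [sq_nonneg (√((n : ℝ) + 1) - √(n : ℝ))]
    push_cast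
    linarith

lemma tsum_int_inv_sqrt_le {x : ℝ} (hx : 1 ≤ x) :
    ∑' t : ℤ, ind (|(t : ℝ)| ≤ x) * ENNReal.ofReal (1 / √(max |(t : ℝ)| 1)) ≤
      ENNReal.ofReal (6 * √x) := by
  have h := tsum_natAbs_le
    (fun n => ind ((n : ℝ) ≤ x) * ENNReal.ofReal (1 / √(max (n : ℝ) 1)))
  simp only [natAbs_cast_real] at h
  refine h.trans ?_
  have h2 := tsum_nat_ind_le_mul x (fun n => ENNReal.ofReal (1 / √(max (n : ℝ) 1)))
  have h3 : ∑ n ∈ Finset.range (⌊x⌋₊ + 1), 1 / √(max (n : ℝ) 1) ≤ 3 * √x := by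
    rw [Finset.sum_range_succ']
    have h4 : ∀ k ∈ Finset.range ⌊x⌋₊,
        1 / √(max (((k + 1 : ℕ) : ℝ)) 1) = 1 / √((k : ℝ) + 1) := by
      intro k _
      rw [max_eq_left (by simp)]
      push_cast
      rfl
    rw [Finset.sum_congr rfl h4]
    have h5 := sum_range_inv_sqrt_le ⌊x⌋₊
    have h6 : √((⌊x⌋₊ : ℕ) : ℝ) ≤ √x := Real.sqrt_le_sqrt (Nat.floor_le (by linarith))
    have h7 : 1 ≤ √x := Real.one_le_sqrt.2 hx
    simp only [Nat.cast_zero, zero_le_one, sup_of_le_right, Real.sqrt_one, div_one]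
    linarith
  calc _ ≤ 2 * ∑ n ∈ Finset.range (⌊x⌋₊ + 1), ENNReal.ofReal (1 / √(max (n : ℝ) 1)) := by
        gcongr
    _ = ENNReal.ofReal (2 * ∑ n ∈ Finset.range (⌊x⌋₊ + 1), 1 / √(max (n : ℝ) 1)) := by
        rw [ENNReal.ofReal_mul (by norm_num), ENNReal.ofReal_sum_of_nonneg
          (fun i _ => by positivity)]
        simp
    _ ≤ _ := ENNReal.ofReal_le_ofReal (by linarith)

lemma tsum_int_inv_le {x : ℝ} (hx : 1 ≤ x) :
    ∑' t : ℤ, ind (|(t : ℝ)| ≤ x) * ENNReal.ofReal (1 / max |(t : ℝ)| 1) ≤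
      ENNReal.ofReal (4 + 2 * Real.log x) := by
  have h := tsum_natAbs_le
    (fun n => ind ((n : ℝ) ≤ x) * ENNReal.ofReal (1 / max (n : ℝ) 1))
  simp only [natAbs_cast_real] at h
  refine h.trans ?_
  have h2 := tsum_nat_ind_le_mul x (fun n => ENNReal.ofReal (1 / max (n : ℝ) 1))
  have h3 : ∑ n ∈ Finset.range (⌊x⌋₊ + 1), 1 / max (n : ℝ) 1 ≤ 2 + Real.log x := by
    rw [Finset.sum_range_succ']
    have h4 : ∀ k ∈ Finset.range ⌊x⌋₊,
        1 / max (((k + 1 : ℕ) : ℝ)) 1 = ((k : ℝ) + 1)⁻¹ := by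
      intro k _
      rw [max_eq_left (by simp)]
      push_cast
      rw [one_div]
    rw [Finset.sum_congr rfl h4]
    have h5 := harmonic_floor_le_one_add_log x hx
    simp only [harmonic] at h5
    push_cast at h5
    simp only [Nat.cast_zero, zero_le_one, sup_of_le_right, div_one]
    linarith
  calc _ ≤ 2 * ∑ n ∈ Finset.range (⌊x⌋₊ + 1), ENNReal.ofReal (1 / max (n : ℝ) 1) := by
        gcongr
    _ = ENNReal.ofReal (2 * ∑ n ∈ Finset.range (⌊x⌋₊ + 1), 1 / max (n : ℝ) 1) := by
        rw [ENNReal.ofReal_mul (by norm_num), ENNReal.ofReal_sum_of_nonneg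
          (fun i _ => by positivity)]
        simp
    _ ≤ _ := ENNReal.ofReal_le_ofReal (by linarith)

lemma SL2Z.det_eq (γ : SL2Z) : γ 0 0 * γ 1 1 - γ 0 1 * γ 1 0 = 1 := by
  have h := γ.det_coe
  rwa [Matrix.det_fin_two] at h

lemma SL2Z.ext_entries {γ δ : SL2Z} (h1 : γ 0 0 = δ 0 0) (h2 : γ 0 1 = δ 0 1)
    (h3 : γ 1 0 = δ 1 0) (h4 : γ 1 1 = δ 1 1) : γ = δ := by
  ext i j
  fin_cases i <;> fin_cases j <;> assumption

lemma SL2Z.mul_00 (γ δ : SL2Z) : (γ * δ) 0 0 = γ 0 0 * δ 0 0 + γ 0 1 * δ 1 0 := by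
  simp [Matrix.mul_apply, Fin.sum_univ_two]

lemma SL2Z.mul_01 (γ δ : SL2Z) : (γ * δ) 0 1 = γ 0 0 * δ 0 1 + γ 0 1 * δ 1 1 := by
  simp [Matrix.mul_apply, Fin.sum_univ_two]

lemma SL2Z.mul_10 (γ δ : SL2Z) : (γ * δ) 1 0 = γ 1 0 * δ 0 0 + γ 1 1 * δ 1 0 := by
  simp [Matrix.mul_apply, Fin.sum_univ_two]

lemma SL2Z.mul_11 (γ δ : SL2Z) : (γ * δ) 1 1 = γ 1 0 * δ 0 1 + γ 1 1 * δ 1 1 := by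
  simp [Matrix.mul_apply, Fin.sum_univ_two]

lemma SL2Z.inv_00 (γ : SL2Z) : γ⁻¹ 0 0 = γ 1 1 := by
  simp [SpecialLinearGroup.SL2_inv_expl]

lemma SL2Z.inv_01 (γ : SL2Z) : γ⁻¹ 0 1 = -γ 0 1 := by
  simp [SpecialLinearGroup.SL2_inv_expl]

lemma SL2Z.inv_10 (γ : SL2Z) : γ⁻¹ 1 0 = -γ 1 0 := by
  simp [SpecialLinearGroup.SL2_inv_expl]

lemma SL2Z.inv_11 (γ : SL2Z) : γ⁻¹ 1 1 = γ 0 0 := by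
  simp [SpecialLinearGroup.SL2_inv_expl]

/-- The unipotent matrix `(1 n; 0 1)`. -/
def unip (n : ℤ) : SL2Z := ⟨!![1, n; 0, 1], by simp [Matrix.det_fin_two]⟩

lemma abs_le_of_mul_sq_le {A Y x : ℝ} (hA : 0 < A) (h : A * x ^ 2 ≤ Y) : |x| ≤ √(Y / A) := by
  apply Real.abs_le_sqrt
  rw [le_div_iff₀ hA]
  linarith

lemma one_le_abs_cast {n : ℤ} (h : n ≠ 0) : (1 : ℝ) ≤ |(n : ℝ)| := by
  exact_mod_cast Int.one_le_abs h

lemma tsum_int_abs_le_one : ∑' t : ℤ, ind (|(t : ℝ)| ≤ 1) ≤ 4 := by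
  refine (tsum_int_abs_le (L := 1) (by norm_num)).trans ?_
  norm_num

lemma tsum_prod_mul {α β : Type*} (f : α → ℝ≥0∞) (g : β → ℝ≥0∞) :
    ∑' p : α × β, f p.1 * g p.2 = (∑' a, f a) * ∑' b, g b := by
  rw [ENNReal.tsum_prod (f := fun a b => f a * g b)]
  simp only [ENNReal.tsum_mul_left, ENNReal.tsum_mul_right]

/-- Matrices with lower left entry zero in a skew box. -/
lemma diag_count_zero {A C Y β : ℝ} (hA : 0 < A) (hC : 0 < C) (hβ : 1 ≤ β) :
    ∑' δ : SL2Z, ind (δ 1 0 = 0 ∧ A * (δ 0 0 : ℝ) ^ 2 + C * (δ 1 0 : ℝ) ^ 2 ≤ Y / β ∧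
      A * (δ 0 1 : ℝ) ^ 2 + C * (δ 1 1 : ℝ) ^ 2 ≤ Y * β) ≤
    ind (A ≤ Y / β ∧ C ≤ Y * β) * ENNReal.ofReal (16 * √(Y * β / A)) := by
  set P : SL2Z → Prop := fun δ => δ 1 0 = 0 ∧
      A * (δ 0 0 : ℝ) ^ 2 + C * (δ 1 0 : ℝ) ^ 2 ≤ Y / β ∧
      A * (δ 0 1 : ℝ) ^ 2 + C * (δ 1 1 : ℝ) ^ 2 ≤ Y * β with hP
  have key : ∀ δ, P δ → |(δ 0 0 : ℝ)| = 1 ∧ |(δ 1 1 : ℝ)| = 1 := by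
    rintro δ ⟨h0, -, -⟩
    have hd := δ.det_eq
    rw [h0, mul_zero, sub_zero] at hd
    have h1 := Int.isUnit_iff.1 (IsUnit.of_mul_eq_one _ hd)
    have h2 := Int.isUnit_iff.1 (IsUnit.of_mul_eq_one _ ((mul_comm _ _).trans hd))
    constructor
    · rcases h1 with h | h <;> simp [h]
    · rcases h2 with h | h <;> simp [h]
  have sq1 : ∀ x : ℝ, |x| = 1 → x ^ 2 = 1 := fun x hx => by rw [← sq_abs, hx]; norm_num
  by_cases hc : A ≤ Y / β ∧ C ≤ Y * β
  · rw [ind_of hc, one_mul]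
    have h := tsum_ind_le_of_injOn (P := P) (fun δ => (δ 0 0, δ 0 1))
      (fun p : ℤ × ℤ => ind (|(p.1 : ℝ)| ≤ 1) * ind (|(p.2 : ℝ)| ≤ √(Y * β / A)))
      (fun _ => 1) ?_ ?_
    · simp only [mul_one] at h
      refine h.trans ?_
      rw [tsum_prod_mul (fun a : ℤ => ind (|(a : ℝ)| ≤ 1))
        (fun b : ℤ => ind (|(b : ℝ)| ≤ √(Y * β / A)))]
      have h1 : 1 ≤ √(Y * β / A) := by
        apply Real.one_le_sqrt.2
        rw [one_le_div hA]
        have : 0 ≤ Y / β := hA.le.trans hc.1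
        have hY : 0 ≤ Y := by
          rwa [le_div_iff₀ (by linarith), zero_mul] at this
        calc A ≤ Y / β := hc.1
          _ ≤ Y := div_le_self hY hβ
          _ ≤ Y * β := le_mul_of_one_le_right hY hβ
      calc _ ≤ 4 * ENNReal.ofReal (2 * √(Y * β / A) + 2) :=
            mul_le_mul' tsum_int_abs_le_one (tsum_int_abs_le (by positivity))
        _ = ENNReal.ofReal (4 * (2 * √(Y * β / A) + 2)) := by
            rw [ENNReal.ofReal_mul (by norm_num)]; norm_num
        _ ≤ _ := ENNReal.ofReal_le_ofReal (by linarith)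
    · intro x y hx hy hxy
      simp only [Prod.mk.injEq] at hxy
      have dx := x.det_eq
      have dy := y.det_eq
      rw [hx.1, mul_zero, sub_zero] at dx
      rw [hy.1, mul_zero, sub_zero, ← hxy.1] at dy
      refine SL2Z.ext_entries hxy.1 hxy.2 (hx.1.trans hy.1.symm) ?_
      have : x 0 0 ≠ 0 := fun h => by simp [h] at dx
      exact mul_left_cancel₀ this (dx.trans dy.symm)
    · intro x hx
      obtain ⟨h1, h2⟩ := key x hx
      rw [ind_of h1.le, one_mul, ind_of]
      apply abs_le_of_mul_sq_le hA
      have := hx.2.2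
      nlinarith [sq_nonneg (x 1 1 : ℝ)]
  · rw [ind_of_not hc, zero_mul, nonpos_iff_eq_zero, ENNReal.tsum_eq_zero]
    intro δ
    apply ind_of_not
    intro h
    obtain ⟨h1, h2⟩ := key δ h
    obtain ⟨h3, h4, h5⟩ := h
    rw [sq1 _ h1, h3] at h4
    rw [sq1 _ h2] at h5
    refine hc ⟨by simpa using h4, ?_⟩
    nlinarith [sq_nonneg (δ 0 1 : ℝ)]

/-- Matrices with nonzero lower left entry in a skew box. -/
lemma diag_count_ne_zero {A C Y β : ℝ} (hA : 0 < A) (hAC : A ≤ C) (hY : 0 < Y)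
    (hβ : 1 ≤ β) :
    ∑' δ : SL2Z, ind (δ 1 0 ≠ 0 ∧ A * (δ 0 0 : ℝ) ^ 2 + C * (δ 1 0 : ℝ) ^ 2 ≤ Y / β ∧
      A * (δ 0 1 : ℝ) ^ 2 + C * (δ 1 1 : ℝ) ^ 2 ≤ Y * β) ≤
    ENNReal.ofReal (216 * (Y / √(A * C))) := by
  classical
  set P : SL2Z → Prop := fun δ => δ 1 0 ≠ 0 ∧
      A * (δ 0 0 : ℝ) ^ 2 + C * (δ 1 0 : ℝ) ^ 2 ≤ Y / β ∧
      A * (δ 0 1 : ℝ) ^ 2 + C * (δ 1 1 : ℝ) ^ 2 ≤ Y * β with hP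
  have hC : 0 < C := hA.trans_le hAC
  have hβ0 : 0 < β := by linarith
  set a0 := √(Y / β / A) with ha0
  set c0 := √(Y / β / C) with hc0
  have hca : c0 ≤ a0 := Real.sqrt_le_sqrt (by gcongr)
  have bnd : ∀ δ, P δ → |(δ 0 0 : ℝ)| ≤ a0 ∧ |(δ 1 0 : ℝ)| ≤ c0 ∧
      |(δ 0 1 : ℝ)| ≤ β * a0 ∧ |(δ 1 1 : ℝ)| ≤ β * c0 := by
    rintro δ ⟨-, h1, h2⟩
    have e : ∀ Z, 0 < Z → β * √(Y / β / Z) = √(Y * β / Z) := by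
      intro Z hZ
      rw [show Y * β / Z = β ^ 2 * (Y / β / Z) by field_simp, Real.sqrt_mul (by positivity),
        Real.sqrt_sq hβ0.le]
    rw [ha0, hc0, e A hA, e C hC]
    refine ⟨abs_le_of_mul_sq_le hA ?_, abs_le_of_mul_sq_le hC ?_,
      abs_le_of_mul_sq_le hA ?_, abs_le_of_mul_sq_le hC ?_⟩
    · nlinarith [sq_nonneg (δ 1 0 : ℝ)]
    · nlinarith [sq_nonneg (δ 0 0 : ℝ)]
    · nlinarith [sq_nonneg (δ 1 1 : ℝ)]
    · nlinarith [sq_nonneg (δ 0 1 : ℝ)]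
  by_cases hc1 : 1 ≤ c0
  swap
  · have : ∀ δ, ind (P δ) = 0 := fun δ => ind_of_not fun h =>
      hc1 ((one_le_abs_cast h.1).trans (bnd δ h).2.1)
    change ∑' δ, ind (P δ) ≤ _
    simp [this]
  have ha1 : 1 ≤ a0 := hc1.trans hca
  set L : ℤ → ℤ → ℝ := fun a c => 2 * β * (√(a0 * c0) *
    ((1 / √(max |(a : ℝ)| 1)) * (1 / √(max |(c : ℝ)| 1)))) with hL
  have hL0 : ∀ a c, 0 ≤ L a c := fun a c => by positivity
  set rep : ℤ → ℤ → SL2Z := fun a c =>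
    if h : ∃ δ, P δ ∧ δ 0 0 = a ∧ δ 1 0 = c then h.choose else 1 with hrep
  have rep_spec : ∀ δ, P δ → P (rep (δ 0 0) (δ 1 0)) ∧
      rep (δ 0 0) (δ 1 0) 0 0 = δ 0 0 ∧ rep (δ 0 0) (δ 1 0) 1 0 = δ 1 0 := by
    intro δ hδ
    have h : ∃ δ', P δ' ∧ δ' 0 0 = δ 0 0 ∧ δ' 1 0 = δ 1 0 := ⟨δ, hδ, rfl, rfl⟩
    simp only [hrep, dif_pos h]
    exact h.choose_spec
  have tr : ∀ δ r : SL2Z, r 0 0 = δ 0 0 → r 1 0 = δ 1 0 →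
      (r 1 1 * δ 0 1 - r 0 1 * δ 1 1) * δ 0 0 = δ 0 1 - r 0 1 ∧
      (r 1 1 * δ 0 1 - r 0 1 * δ 1 1) * δ 1 0 = δ 1 1 - r 1 1 := by
    intro δ r h1 h2
    have d1 := δ.det_eq
    have d2 := r.det_eq
    rw [h1, h2] at d2
    constructor
    · linear_combination (δ 0 1) * d2 - (r 0 1) * d1
    · linear_combination (δ 1 1) * d2 - (r 1 1) * d1
  have h := tsum_ind_le_of_injOn (P := P)
    (fun δ => ((δ 0 0, δ 1 0), rep (δ 0 0) (δ 1 0) 1 1 * δ 0 1 - rep (δ 0 0) (δ 1 0) 0 1 * δ 1 1))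
    (fun p : (ℤ × ℤ) × ℤ => ind (|(p.1.1 : ℝ)| ≤ a0) * ind (|(p.1.2 : ℝ)| ≤ c0) *
      ind (|(p.2 : ℝ)| ≤ L p.1.1 p.1.2)) (fun _ => 1) ?_ ?_
  · simp only [mul_one] at h
    refine h.trans ?_
    rw [ENNReal.tsum_prod (f := fun (p : ℤ × ℤ) (t : ℤ) =>
      ind (|(p.1 : ℝ)| ≤ a0) * ind (|(p.2 : ℝ)| ≤ c0) * ind (|(t : ℝ)| ≤ L p.1 p.2))]
    simp only [ENNReal.tsum_mul_left]
    have h2 : ∀ p : ℤ × ℤ, ind (|(p.1 : ℝ)| ≤ a0) * ind (|(p.2 : ℝ)| ≤ c0) *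
        ∑' t : ℤ, ind (|(t : ℝ)| ≤ L p.1 p.2) ≤
        ENNReal.ofReal (6 * β * √(a0 * c0)) *
        ((ind (|(p.1 : ℝ)| ≤ a0) * ENNReal.ofReal (1 / √(max |(p.1 : ℝ)| 1))) *
        (ind (|(p.2 : ℝ)| ≤ c0) * ENNReal.ofReal (1 / √(max |(p.2 : ℝ)| 1)))) := by
      rintro ⟨a, c⟩
      dsimp only
      have e : ENNReal.ofReal (6 * β * √(a0 * c0)) *
        ((ind (|(a : ℝ)| ≤ a0) * ENNReal.ofReal (1 / √(max |(a : ℝ)| 1))) *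
        (ind (|(c : ℝ)| ≤ c0) * ENNReal.ofReal (1 / √(max |(c : ℝ)| 1)))) =
        ind (|(a : ℝ)| ≤ a0 ∧ |(c : ℝ)| ≤ c0) * ENNReal.ofReal (3 * L a c) := by
        rw [← ind_mul_ind, hL, show 3 * (2 * β * (√(a0 * c0) *
          ((1 / √(max |(a : ℝ)| 1)) * (1 / √(max |(c : ℝ)| 1))))) = 6 * β * √(a0 * c0) *
          ((1 / √(max |(a : ℝ)| 1)) * (1 / √(max |(c : ℝ)| 1))) by ring,
          ENNReal.ofReal_mul (p := 6 * β * √(a0 * c0)) (by positivity),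
          ENNReal.ofReal_mul (p := 1 / √(max |(a : ℝ)| 1)) (by positivity)]
        ring
      rw [e, ind_mul_ind]
      apply ind_mul_le_ind_mul
      rintro ⟨h1, h2⟩
      refine (tsum_int_abs_le (hL0 a c)).trans (ENNReal.ofReal_le_ofReal ?_)
      have h3 : 2 ≤ L a c := by
        have ha : √(max |(a : ℝ)| 1) ≤ √a0 := Real.sqrt_le_sqrt (max_le h1 ha1)
        have hc : √(max |(c : ℝ)| 1) ≤ √c0 := Real.sqrt_le_sqrt (max_le h2 hc1)
        have ha' : 0 < √(max |(a : ℝ)| 1) := Real.sqrt_pos.2 (by positivity)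
        have hc' : 0 < √(max |(c : ℝ)| 1) := Real.sqrt_pos.2 (by positivity)
        have : 1 ≤ √(a0 * c0) *
          ((1 / √(max |(a : ℝ)| 1)) * (1 / √(max |(c : ℝ)| 1))) := by
          rw [Real.sqrt_mul (by positivity), div_mul_div_comm, one_mul, mul_one_div,
            le_div_iff₀ (by positivity), one_mul]
          gcongr
        calc (2 : ℝ) = 2 * 1 * 1 := by norm_num
          _ ≤ 2 * β * _ := by gcongr
      linarith
    refine (ENNReal.tsum_le_tsum h2).trans ?_
    rw [ENNReal.tsum_mul_left, tsum_prod_mul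
      (fun a : ℤ => ind (|(a : ℝ)| ≤ a0) * ENNReal.ofReal (1 / √(max |(a : ℝ)| 1)))
      (fun c : ℤ => ind (|(c : ℝ)| ≤ c0) * ENNReal.ofReal (1 / √(max |(c : ℝ)| 1)))]
    calc _ ≤ ENNReal.ofReal (6 * β * √(a0 * c0)) *
          (ENNReal.ofReal (6 * √a0) * ENNReal.ofReal (6 * √c0)) := by
          gcongr
          · exact tsum_int_inv_sqrt_le ha1
          · exact tsum_int_inv_sqrt_le hc1
      _ = ENNReal.ofReal (216 * (Y / √(A * C))) := by
          rw [← ENNReal.ofReal_mul (by positivity), ← ENNReal.ofReal_mul (by positivity)]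
          congr 1
          have e1 : √a0 * √c0 = √(a0 * c0) := (Real.sqrt_mul (by positivity) _).symm
          have e2 : √(a0 * c0) * √(a0 * c0) = a0 * c0 := Real.mul_self_sqrt (by positivity)
          have e3 : a0 * c0 = Y / β / √(A * C) := by
            rw [ha0, hc0, Real.sqrt_div (show 0 ≤ Y / β by positivity) A,
              Real.sqrt_div (show 0 ≤ Y / β by positivity) C,
              div_mul_div_comm, Real.mul_self_sqrt (by positivity), Real.sqrt_mul hA.le]
          calc _ = 216 * β * (√(a0 * c0) * (√a0 * √c0)) := by ring
            _ = 216 * (Y / √(A * C)) := by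
              rw [e1, e2, e3]
              field_simp
  · intro x y hx hy hxy
    simp only [Prod.mk.injEq] at hxy
    obtain ⟨⟨e1, e2⟩, e3⟩ := hxy
    obtain ⟨-, s1, s2⟩ := rep_spec x hx
    obtain ⟨-, s3, s4⟩ := rep_spec y hy
    have t1 := tr x _ s1 s2
    have t2 := tr y _ s3 s4
    rw [← e3, ← e1, ← e2] at t2
    refine SL2Z.ext_entries e1 ?_ e2 ?_ <;> linarith
  · intro x hx
    obtain ⟨s0, s1, s2⟩ := rep_spec x hx
    have t1 := tr x _ s1 s2
    set r := rep (x 0 0) (x 1 0)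
    obtain ⟨b1, b2, b3, b4⟩ := bnd x hx
    obtain ⟨-, -, b5, b6⟩ := bnd r s0
    set t := r 1 1 * x 0 1 - r 0 1 * x 1 1
    dsimp only
    rw [ind_of b1, ind_of b2, one_mul, one_mul, ind_of]
    have u1 : |(t : ℝ)| * |(x 0 0 : ℝ)| ≤ 2 * β * a0 := by
      rw [← abs_mul, show (t : ℝ) * x 0 0 = x 0 1 - r 0 1 by exact_mod_cast t1.1]
      calc _ ≤ |(x 0 1 : ℝ)| + |(r 0 1 : ℝ)| := abs_sub _ _
        _ ≤ _ := by linarith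
    have u2 : |(t : ℝ)| * |(x 1 0 : ℝ)| ≤ 2 * β * c0 := by
      rw [← abs_mul, show (t : ℝ) * x 1 0 = x 1 1 - r 1 1 by exact_mod_cast t1.2]
      calc _ ≤ |(x 1 1 : ℝ)| + |(r 1 1 : ℝ)| := abs_sub _ _
        _ ≤ _ := by linarith
    have c1 := one_le_abs_cast hx.1
    have u3 : |(t : ℝ)| * max |(x 0 0 : ℝ)| 1 ≤ 2 * β * a0 := by
      rcases le_total 1 |(x 0 0 : ℝ)| with h1 | h1
      · rwa [max_eq_left h1]
      · rw [max_eq_right h1]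
        calc |(t : ℝ)| * 1 ≤ |(t : ℝ)| * |(x 1 0 : ℝ)| := by gcongr
          _ ≤ 2 * β * c0 := u2
          _ ≤ _ := by gcongr
    rw [← max_eq_left c1] at u2
    have hm1 : 0 < max |(x 0 0 : ℝ)| 1 := by positivity
    have hm2 : 0 < max |(x 1 0 : ℝ)| 1 := by positivity
    have u4 : |(t : ℝ)| ≤ √((2 * β) ^ 2 * (a0 * c0) /
        (max |(x 0 0 : ℝ)| 1 * max |(x 1 0 : ℝ)| 1)) := by
      apply Real.le_sqrt_of_sq_le
      rw [le_div_iff₀ (by positivity)]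
      calc _ = (|(t : ℝ)| * max |(x 0 0 : ℝ)| 1) * (|(t : ℝ)| * max |(x 1 0 : ℝ)| 1) := by ring
        _ ≤ (2 * β * a0) * (2 * β * c0) := by gcongr
        _ = _ := by ring
    refine u4.trans (le_of_eq ?_)
    rw [Real.sqrt_div (by positivity), Real.sqrt_mul (by positivity),
      Real.sqrt_sq (by positivity), Real.sqrt_mul hm1.le, hL]
    field_simp

lemma diag_count {A C Y β : ℝ} (hA : 0 < A) (hAC : A ≤ C) (hY : 0 < Y) (hβ : 1 ≤ β) :
    ∑' δ : SL2Z, ind (A * (δ 0 0 : ℝ) ^ 2 + C * (δ 1 0 : ℝ) ^ 2 ≤ Y / β ∧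
      A * (δ 0 1 : ℝ) ^ 2 + C * (δ 1 1 : ℝ) ^ 2 ≤ Y * β) ≤
    ENNReal.ofReal (216 * (Y / √(A * C))) +
    ind (A ≤ Y / β ∧ C ≤ Y * β) * ENNReal.ofReal (16 * √(Y * β / A)) := by
  refine le_trans ?_ (add_le_add (diag_count_ne_zero hA hAC hY hβ)
    (diag_count_zero (Y := Y) hA (hA.trans_le hAC) hβ))
  rw [← ENNReal.tsum_add]
  refine ENNReal.tsum_le_tsum fun δ => ?_
  by_cases h : δ 1 0 = 0
  · exact le_add_left (ind_mono fun hbox => ⟨h, hbox⟩)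
  · exact le_add_right (ind_mono fun hbox => ⟨h, hbox⟩)

/-- Binary quadratic form with coefficients `(A, 2B, C)`. -/
def qv (A B C x y : ℝ) : ℝ := A * x ^ 2 + 2 * B * x * y + C * y ^ 2

open UpperHalfPlane in
/-- Gauss reduction of positive definite real binary quadratic forms. -/
lemma exists_reduced {A B C : ℝ} (hA : 0 < A) (hD : 0 < A * C - B ^ 2) :
    ∃ δ : SL2Z, ∃ A' B' C' : ℝ, 0 < A' ∧ A' ≤ C' ∧ 2 * |B'| ≤ A' ∧
      A' * C' - B' ^ 2 = A * C - B ^ 2 ∧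
      ∀ x y : ℝ, qv A B C (δ 0 0 * x + δ 0 1 * y) (δ 1 0 * x + δ 1 1 * y) = qv A' B' C' x y := by
  set s := √(A * C - B ^ 2)
  have hs : 0 < s := Real.sqrt_pos.2 hD
  have hss : s ^ 2 = A * C - B ^ 2 := Real.sq_sqrt hD.le
  set z : ℍ := ⟨⟨B / A, s / A⟩, by positivity⟩ with hz
  obtain ⟨g, hg1, hg2⟩ := ModularGroup.exists_smul_mem_fd z
  have hdet := SL2Z.det_eq g
  set a := g 0 0
  set b := g 0 1
  set c := g 1 0
  set d := g 1 1
  have hdR : (a : ℝ) * d - b * c = 1 := by exact_mod_cast hdet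
  set x0 := B / A with hx0
  set y0 := s / A with hy0
  have hy0p : 0 < y0 := by positivity
  have hB : B = A * x0 := by rw [hx0]; field_simp
  have hC : C = A * (x0 ^ 2 + y0 ^ 2) := by
    rw [hx0, hy0, div_pow, div_pow, hss]; field_simp; ring
  have hform : ((g • z : ℍ) : ℂ) = ((a : ℂ) * z + b) / ((c : ℂ) * z + d) := by
    simpa using coe_specialLinearGroup_apply g z
  have hzc : (z : ℂ) = ⟨x0, y0⟩ := rfl
  have hden : ((c : ℂ) * z + d) ≠ 0 := by
    intro h
    have h1 := congrArg Complex.im h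
    have h2 := congrArg Complex.re h
    simp [hzc, hy0p.ne'] at h1 h2
    rw [h1] at h2
    simp at h2
    rw [h1] at hdR
    rw [show d = 0 by exact_mod_cast h2] at hdR
    simp at hdR
  have hN : 0 < Complex.normSq ((c : ℂ) * z + d) := Complex.normSq_pos.2 hden
  have e1 : Complex.normSq ((c : ℂ) * z + d) = (c * x0 + d) ^ 2 + (c * y0) ^ 2 := by
    rw [Complex.normSq_apply, hzc]; simp; ring
  have e2 : Complex.normSq ((a : ℂ) * z + b) = (a * x0 + b) ^ 2 + (a * y0) ^ 2 := by
    rw [Complex.normSq_apply, hzc]; simp; ring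
  rw [hform, Complex.normSq_div, one_le_div hN, e1, e2] at hg1
  have e3 : (((a : ℂ) * z + b) / ((c : ℂ) * z + d)).re * ((c * x0 + d) ^ 2 + (c * y0) ^ 2) =
      (a * x0 + b) * (c * x0 + d) + a * c * y0 ^ 2 := by
    rw [Complex.div_re, e1, ← add_div, div_mul_cancel₀ _ (by rw [← e1]; exact hN.ne'), hzc]
    simp; ring
  have hre : (g • z : ℍ).re = (((a : ℂ) * z + b) / ((c : ℂ) * z + d)).re := by
    rw [← hform]; rfl
  rw [hre] at hg2
  rw [e1] at hN
  refine ⟨⟨!![d, b; c, a], by rw [Matrix.det_fin_two]; simpa [mul_comm] using hdet⟩,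
    A * ((c * x0 + d) ^ 2 + (c * y0) ^ 2), A * ((a * x0 + b) * (c * x0 + d) + a * c * y0 ^ 2),
    A * ((a * x0 + b) ^ 2 + (a * y0) ^ 2), by positivity, by gcongr, ?_, ?_, ?_⟩
  · rw [abs_mul, abs_of_pos hA, ← e3, abs_mul, abs_of_pos hN]
    have := mul_le_mul_of_nonneg_right hg2 (mul_pos hA hN).le
    linarith
  · rw [hB, hC]
    have : (A * A * y0 ^ 2) * ((a : ℝ) * d - b * c) ^ 2 = A * A * y0 ^ 2 := by rw [hdR]; ring
    linear_combination this
  · intro x y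
    simp only [qv, of_apply, cons_val', cons_val_zero, cons_val_one, cons_val_fin_one]
    rw [hB, hC]
    ring

lemma qv_reduced_ge {A B C : ℝ} (hA : 0 < A) (hAC : A ≤ C) (hB : 2 * |B| ≤ A) (x y : ℝ) :
    A / 2 * x ^ 2 + C / 2 * y ^ 2 ≤ qv A B C x y := by
  have h1 : -(2 * B * x * y) ≤ A * |x| * |y| := by
    calc _ ≤ |2 * B * x * y| := neg_le_abs _
      _ = 2 * |B| * |x| * |y| := by simp [abs_mul]
      _ ≤ _ := by gcongr
  have h2 : A * |x| * |y| ≤ A / 2 * x ^ 2 + C / 2 * y ^ 2 := by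
    have := sq_nonneg (|x| - |y|)
    rw [sub_sq, sq_abs, sq_abs] at this
    nlinarith [sq_nonneg y]
  unfold qv
  linarith

lemma tsum_geom_half : ∑' k : ℕ, ENNReal.ofReal ((1 / 2) ^ k) = 2 := by
  rw [← ENNReal.ofReal_tsum_of_nonneg (fun k => by positivity) summable_geometric_two,
    tsum_geometric_two]
  norm_num

lemma tsum_geom_quarter : ∑' k : ℕ, ENNReal.ofReal ((1 / 4) ^ k) ≤ 2 := by
  rw [← tsum_geom_half]
  exact ENNReal.tsum_le_tsum fun k => ENNReal.ofReal_le_ofReal (by gcongr; norm_num)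

lemma tsum_ind_geom_half_le {s : ℝ} (hs : 0 < s) :
    ∑' k : ℕ, ind (s ≤ 2 ^ k) * ENNReal.ofReal ((1 / 2) ^ k) ≤ ENNReal.ofReal (2 / s) := by
  classical
  obtain ⟨k1, hk1⟩ := pow_unbounded_of_one_lt s (one_lt_two : (1 : ℝ) < 2)
  have hex : ∃ k : ℕ, s ≤ 2 ^ k := ⟨k1, hk1.le⟩
  set k0 := Nat.find hex
  have h0 : s ≤ 2 ^ k0 := Nat.find_spec hex
  have hmin : ∀ k : ℕ, s ≤ 2 ^ k → k0 ≤ k := fun k hk => Nat.find_min' hex hk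
  refine (tsum_ind_le_of_injOn (P := fun k : ℕ => s ≤ 2 ^ k) (fun k => k - k0)
    (fun j => ENNReal.ofReal ((1 / 2) ^ k0) * ENNReal.ofReal ((1 / 2) ^ j)) _ ?_ ?_).trans ?_
  · intro x y hx hy hxy
    have := hmin x hx
    have := hmin y hy
    omega
  · intro x hx
    rw [← ENNReal.ofReal_mul (by positivity), ← pow_add, Nat.add_sub_cancel' (hmin x hx)]
  · rw [ENNReal.tsum_mul_left, tsum_geom_half, show (2 : ℝ≥0∞) = ENNReal.ofReal 2 by norm_num,
      ← ENNReal.ofReal_mul (by positivity)]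
    apply ENNReal.ofReal_le_ofReal
    rw [one_div, inv_pow, le_div_iff₀ hs, mul_comm _ (2 : ℝ), mul_assoc]
    have : (2 ^ k0 : ℝ)⁻¹ * s ≤ 1 := by
      rw [inv_mul_le_iff₀ (by positivity)]; linarith
    linarith

/-- Number of matrices in a family of skew boxes attached to a quadratic form. -/
lemma tsum_skew_box_le {A B C X : ℝ} (hA : 0 < A) (hD : 0 < A * C - B ^ 2) (hX : 0 < X) :
    ∑' k : ℕ, ENNReal.ofReal ((1 / 4) ^ k) * ∑' δ : SL2Z,
      ind (qv A B C (δ 0 0) (δ 1 0) ≤ X / 4 ^ k ∧ qv A B C (δ 0 1) (δ 1 1) ≤ X * 4 ^ k) ≤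
    ENNReal.ofReal (1000 * (X / √(A * C - B ^ 2))) := by
  obtain ⟨δ0, A', B', C', hA', hAC', hB', hD', hq⟩ := exists_reduced hA hD
  have hC' : 0 < C' := hA'.trans_le hAC'
  have step : ∀ k : ℕ, ∑' δ : SL2Z,
      ind (qv A B C (δ 0 0) (δ 1 0) ≤ X / 4 ^ k ∧ qv A B C (δ 0 1) (δ 1 1) ≤ X * 4 ^ k) ≤
      ENNReal.ofReal (216 * (2 * X / √(A' * C'))) +
      ind (√(C' / (2 * X)) ≤ 2 ^ k) * ENNReal.ofReal (16 * √(2 * X / A') * 2 ^ k) := by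
    intro k
    rw [← (Equiv.mulLeft δ0).tsum_eq]
    have h1 := diag_count (Y := 2 * X) (β := 4 ^ k) hA' hAC' (by positivity)
      (one_le_pow₀ (by norm_num))
    refine le_trans (le_trans (ENNReal.tsum_le_tsum fun δ => ind_mono ?_) h1) ?_
    · rintro ⟨h2, h3⟩
      simp only [Equiv.coe_mulLeft, SL2Z.mul_00, SL2Z.mul_01, SL2Z.mul_10, SL2Z.mul_11] at h2 h3
      push_cast at h2 h3
      rw [hq] at h2 h3
      have h4 := qv_reduced_ge hA' hAC' hB' (δ 0 0) (δ 1 0)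
      have h5 := qv_reduced_ge hA' hAC' hB' (δ 0 1) (δ 1 1)
      constructor
      · rw [mul_div_assoc]; linarith
      · linarith
    · refine add_le_add le_rfl (mul_le_mul' ?_ (ENNReal.ofReal_le_ofReal ?_))
      · apply ind_mono
        rintro ⟨-, h⟩
        rw [Real.sqrt_le_iff]
        refine ⟨by positivity, ?_⟩
        rw [div_le_iff₀ (by positivity), ← pow_mul, mul_comm k 2, pow_mul]
        norm_num
        linarith
      · rw [show 2 * X * 4 ^ k / A' = 2 * X / A' * (2 ^ k) ^ 2 by
          rw [← pow_mul, mul_comm k 2, pow_mul]; norm_num; ring, Real.sqrt_mul (by positivity),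
          Real.sqrt_sq (by positivity)]
        exact le_of_eq (by ring)
  have hprod : √(2 * X / A') * (2 / √(C' / (2 * X))) = 4 * X / √(A' * C') := by
    rw [Real.sqrt_div (by positivity), Real.sqrt_div hC'.le, Real.sqrt_mul hA'.le]
    have : √(2 * X) * √(2 * X) = 2 * X := Real.mul_self_sqrt (by positivity)
    have h1 : 0 < √A' := Real.sqrt_pos.2 hA'
    have h2 : 0 < √C' := Real.sqrt_pos.2 hC'
    field_simp
    linear_combination (2 : ℝ) * this
  calc _ ≤ ∑' k : ℕ, (ENNReal.ofReal ((1 / 4) ^ k) *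
        ENNReal.ofReal (216 * (2 * X / √(A' * C'))) +
        ENNReal.ofReal (16 * √(2 * X / A')) *
          (ind (√(C' / (2 * X)) ≤ 2 ^ k) * ENNReal.ofReal ((1 / 2) ^ k))) := by
        refine ENNReal.tsum_le_tsum fun k => ?_
        refine (mul_le_mul_right (step k) _).trans (le_of_eq ?_)
        rw [mul_add]
        congr 1
        rw [mul_left_comm, mul_left_comm (ENNReal.ofReal (16 * √(2 * X / A'))),
          ← ENNReal.ofReal_mul (by positivity), ← ENNReal.ofReal_mul (by positivity)]
        congr 2
        rw [show (4 : ℝ) = 2 * 2 by norm_num]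
        simp only [one_div, mul_inv, inv_pow, mul_pow]
        field_simp
    _ ≤ 2 * ENNReal.ofReal (216 * (2 * X / √(A' * C'))) +
        ENNReal.ofReal (16 * √(2 * X / A')) * ENNReal.ofReal (2 / √(C' / (2 * X))) := by
        rw [ENNReal.tsum_add, ENNReal.tsum_mul_right, ENNReal.tsum_mul_left]
        gcongr
        · exact tsum_geom_quarter
        · exact tsum_ind_geom_half_le (Real.sqrt_pos.2 (by positivity))
    _ = ENNReal.ofReal (928 * (X / √(A' * C'))) := by
        rw [show (2 : ℝ≥0∞) = ENNReal.ofReal 2 by norm_num, ← ENNReal.ofReal_mul (by positivity),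
          ← ENNReal.ofReal_mul (by positivity), ← ENNReal.ofReal_add (by positivity)
          (by positivity), mul_assoc 16, hprod]
        congr 1
        ring
    _ ≤ _ := by
        apply ENNReal.ofReal_le_ofReal
        have h1 : √(A * C - B ^ 2) ≤ √(A' * C') := by
          rw [← hD']; exact Real.sqrt_le_sqrt (by nlinarith [sq_nonneg B'])
        have h2 : 0 < √(A * C - B ^ 2) := Real.sqrt_pos.2 hD
        have : X / √(A' * C') ≤ X / √(A * C - B ^ 2) := by gcongr
        have h3 : 0 ≤ X / √(A * C - B ^ 2) := by positivity
        linarith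

/-- Number of matrices in a standard skew box. -/
lemma skew_box_one_le {X β : ℝ} (hX : 0 < X) (hβ : 1 ≤ β) :
    ∑' δ : SL2Z, ind (qv 1 0 1 (δ 0 0) (δ 1 0) ≤ X / β ∧
      qv 1 0 1 (δ 0 1) (δ 1 1) ≤ X * β) ≤ ENNReal.ofReal (232 * X) := by
  have h := diag_count (A := 1) (C := 1) one_pos le_rfl hX hβ
  refine le_trans (le_trans (ENNReal.tsum_le_tsum fun δ => ind_mono ?_) h) ?_
  · simp [qv]
  · rw [show 232 * X = 216 * (X / √(1 * 1)) + 16 * X by simp; ring,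
      ENNReal.ofReal_add (by positivity) (by positivity)]
    gcongr
    apply ind_mul_le
    rintro ⟨h1, -⟩
    apply ENNReal.ofReal_le_ofReal
    rw [le_div_iff₀ (by linarith), one_mul] at h1
    gcongr
    rw [div_one, Real.sqrt_le_iff]
    refine ⟨hX.le, ?_⟩
    nlinarith

/-- The quadratic form `x² / α + α y²`. -/
def qf (α x y : ℝ) : ℝ := x ^ 2 / α + α * y ^ 2

lemma qf_nonneg {α : ℝ} (hα : 0 < α) (x y : ℝ) : 0 ≤ qf α x y := by
  unfold qf; positivity

/-- Membership in a skew box: the first column has `qf`-size at most `X / 4 ^ k`, the second one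
at most `X * 4 ^ k`. -/
def InBox (i k : ℕ) (X : ℝ) (δ : SL2Z) : Prop :=
  qf (4 ^ i) (δ 0 0) (δ 1 0) ≤ X / 4 ^ k ∧ qf (4 ^ i) (δ 0 1) (δ 1 1) ≤ X * 4 ^ k

lemma unip_00 (n : ℤ) : unip n 0 0 = 1 := rfl
lemma unip_01 (n : ℤ) : unip n 0 1 = n := rfl
lemma unip_10 (n : ℤ) : unip n 1 0 = 0 := rfl
lemma unip_11 (n : ℤ) : unip n 1 1 = 1 := rfl

/-- Scale parameter of a reduced form of bounded discriminant. -/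
lemma exists_scale {A B C : ℝ} (hA' : 0 < A) (hAC' : A ≤ C) (hB' : 2 * |B| ≤ A)
    (hD3 : A * C - B ^ 2 ≤ 3) :
    ∃ k : ℕ, A * 4 ^ k ≤ 4 ∧ C ≤ 4 * 4 ^ k := by
  classical
  have hprod : A * C ≤ 4 := by
    have h1 : 4 * B ^ 2 ≤ A * A := by
      rw [← sq_abs]; nlinarith [abs_nonneg B]
    nlinarith
  have hA'2 : A ≤ 4 := by nlinarith
  have hex : ∃ k : ℕ, 4 < A * 4 ^ (k + 1) := by
    obtain ⟨k, hk⟩ := pow_unbounded_of_one_lt (4 / A) (by norm_num : (1 : ℝ) < 4)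
    refine ⟨k, ?_⟩
    rw [div_lt_iff₀ hA'] at hk
    rw [pow_succ]
    nlinarith [pow_pos (show (0 : ℝ) < 4 by norm_num) k]
  set k := Nat.find hex
  have hk1 : 4 < A * 4 ^ (k + 1) := Nat.find_spec hex
  have hk2 : A * 4 ^ k ≤ 4 := by
    rcases Nat.eq_zero_or_pos k with h0 | h0
    · rw [h0]; simpa using hA'2
    · have := Nat.find_min hex (m := k - 1) (by omega)
      rw [not_lt, Nat.sub_add_cancel h0] at this
      exact this
  have h4k : (1 : ℝ) ≤ 4 ^ k := one_le_pow₀ (by norm_num)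
  have hC4 : C ≤ 4 * 4 ^ k := by
    rw [pow_succ] at hk1
    by_contra! hlt
    have : 1 < A * 4 ^ k := by linarith
    nlinarith
  exact ⟨k, hk2, hC4⟩

lemma factor_form_det {α R S a b c d : ℝ} (hα : 0 < α) (hR : 1 ≤ R) (hS : 1 ≤ S)
    (hdet : a * d - b * c = 1) (h : qf α a c + qf α b d ≤ R * S) :
    0 < (1 / (α * R) + (c ^ 2 + d ^ 2) / S) * (α / R + (a ^ 2 + b ^ 2) / S) -
      (-(b * d + a * c) / S) ^ 2 ∧
    (1 / (α * R) + (c ^ 2 + d ^ 2) / S) * (α / R + (a ^ 2 + b ^ 2) / S) -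
      (-(b * d + a * c) / S) ^ 2 ≤ 3 := by
  have hR0 : 0 < R := by linarith
  have hS0 : 0 < S := by linarith
  have hdetQ : (1 / (α * R) + (c ^ 2 + d ^ 2) / S) * (α / R + (a ^ 2 + b ^ 2) / S) -
      (-(b * d + a * c) / S) ^ 2 =
      1 / R ^ 2 + (qf α a c + qf α b d) / (R * S) + 1 / S ^ 2 := by
    have h1 : (a ^ 2 + b ^ 2) * (c ^ 2 + d ^ 2) - (b * d + a * c) ^ 2 = 1 := by
      have : (a ^ 2 + b ^ 2) * (c ^ 2 + d ^ 2) - (b * d + a * c) ^ 2 = (a * d - b * c) ^ 2 := by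
        ring
      rw [this, hdet]; norm_num
    have h2 : (1 / (α * R) + (c ^ 2 + d ^ 2) / S) * (α / R + (a ^ 2 + b ^ 2) / S) -
        (-(b * d + a * c) / S) ^ 2 = 1 / R ^ 2 + (qf α a c + qf α b d) / (R * S) +
        ((a ^ 2 + b ^ 2) * (c ^ 2 + d ^ 2) - (b * d + a * c) ^ 2) / S ^ 2 := by
      unfold qf
      field_simp
      ring
    rw [h2, h1]
  have hN0 : 0 ≤ qf α a c + qf α b d := add_nonneg (qf_nonneg hα _ _) (qf_nonneg hα _ _)
  rw [hdetQ]
  have h1 : 1 / R ^ 2 ≤ 1 := by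
    rw [div_le_one (by positivity)]; exact one_le_pow₀ hR
  have h2 : 1 / S ^ 2 ≤ 1 := by
    rw [div_le_one (by positivity)]; exact one_le_pow₀ hS
  have h3 : (qf α a c + qf α b d) / (R * S) ≤ 1 := by
    rw [div_le_one (by positivity)]; exact h
  exact ⟨by positivity, by linarith⟩

lemma factor_form_eq {α R S a b c d : ℝ} (hα : 0 < α) (hR : 0 < R) (hS : 0 < S) (x y : ℝ) :
    qv (1 / (α * R) + (c ^ 2 + d ^ 2) / S) (-(b * d + a * c) / S)
      (α / R + (a ^ 2 + b ^ 2) / S) x y =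
    qf α x y / R + qf 1 (d * x - b * y) (-c * x + a * y) / S := by
  unfold qv qf
  field_simp
  ring

/-- Every matrix of bounded size factors through many pairs of matrices in skew boxes. -/
lemma exists_factor {i : ℕ} {γ : SL2Z} {R S : ℝ} (hR : 1 ≤ R) (hS : 1 ≤ S)
    (h : qf (4 ^ i) (γ 0 0) (γ 1 0) + qf (4 ^ i) (γ 0 1) (γ 1 1) ≤ R * S) :
    ∃ k : ℕ, ∃ δ : SL2Z, ∀ n : ℕ, n < 4 ^ k →
      InBox i k (16 * R) (δ * unip n) ∧ InBox 0 k (16 * S) (γ⁻¹ * (δ * unip n)) := by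
  classical
  have hα : (0 : ℝ) < 4 ^ i := by positivity
  set α : ℝ := 4 ^ i with hαdef
  have hR0 : 0 < R := by linarith
  have hS0 : 0 < S := by linarith
  have hdet : (γ 0 0 : ℝ) * γ 1 1 - γ 0 1 * γ 1 0 = 1 := by exact_mod_cast γ.det_eq
  set a : ℝ := ((γ 0 0 : ℤ) : ℝ) with ha
  set b : ℝ := ((γ 0 1 : ℤ) : ℝ) with hb
  set c : ℝ := ((γ 1 0 : ℤ) : ℝ) with hc
  set d : ℝ := ((γ 1 1 : ℤ) : ℝ) with hd
  have hA0 : 0 < 1 / (α * R) + (c ^ 2 + d ^ 2) / S := by positivity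
  obtain ⟨hD0, hD3⟩ := factor_form_det hα hR hS hdet h
  have hQ := factor_form_eq (a := a) (b := b) (c := c) (d := d) hα hR0 hS0
  generalize 1 / (α * R) + (c ^ 2 + d ^ 2) / S = A at hA0 hD0 hD3 hQ
  generalize -(b * d + a * c) / S = B at hD0 hD3 hQ
  generalize α / R + (a ^ 2 + b ^ 2) / S = C at hD0 hD3 hQ
  obtain ⟨δ, A', B', C', hA', hAC', hB', hD', hq⟩ := exists_reduced hA0 hD0
  obtain ⟨k, hk2, hC4⟩ := exists_scale hA' hAC' hB' (hD'.le.trans hD3)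
  have h4k : (1 : ℝ) ≤ 4 ^ k := one_le_pow₀ (by norm_num)
  refine ⟨k, δ, fun n hn => ?_⟩
  have hn' : (n : ℝ) ≤ 4 ^ k := by exact_mod_cast hn.le
  have hn0 : (0 : ℝ) ≤ n := Nat.cast_nonneg n
  set η := δ * unip n
  have e1 : qv A B C (η 0 0) (η 1 0) ≤ 16 / 4 ^ k := by
    have : qv A B C (η 0 0) (η 1 0) = A' := by
      have := hq 1 0
      simp only [η, SL2Z.mul_00, SL2Z.mul_10, unip_00, unip_10]
      push_cast
      rw [this]
      simp [qv]
    rw [this, le_div_iff₀ (by positivity)]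
    linarith
  have e2 : qv A B C (η 0 1) (η 1 1) ≤ 16 * 4 ^ k := by
    have : qv A B C (η 0 1) (η 1 1) = qv A' B' C' n 1 := by
      have := hq n 1
      simp only [η, SL2Z.mul_01, SL2Z.mul_11, unip_01, unip_11]
      push_cast
      exact this
    rw [this]
    unfold qv
    have h1 : 2 * B' * n ≤ A' * n := by nlinarith [le_abs_self B']
    have h2 : A' * n ≤ 4 := by nlinarith
    have h3 : A' * n ^ 2 ≤ 4 * 4 ^ k := by
      calc A' * (n : ℝ) ^ 2 = A' * n * n := by ring
        _ ≤ 4 * 4 ^ k := by gcongr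
    linarith
  have key : ∀ x y Z : ℝ, qv A B C x y ≤ Z → qf α x y ≤ R * Z ∧
      qf 1 (d * x - b * y) (-c * x + a * y) ≤ S * Z := by
    intro x y Z hZ
    rw [hQ] at hZ
    have g1 : 0 ≤ qf α x y / R := div_nonneg (qf_nonneg hα _ _) hR0.le
    have g2 : 0 ≤ qf 1 (d * x - b * y) (-c * x + a * y) / S :=
      div_nonneg (qf_nonneg one_pos _ _) hS0.le
    constructor
    · rw [← div_le_iff₀' hR0]; linarith
    · rw [← div_le_iff₀' hS0]; linarith
  obtain ⟨k1, k2⟩ := key _ _ _ e1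
  obtain ⟨k3, k4⟩ := key _ _ _ e2
  refine ⟨⟨?_, ?_⟩, ?_, ?_⟩
  · calc _ ≤ _ := k1
      _ = _ := by ring
  · calc _ ≤ _ := k3
      _ = _ := by ring
  · rw [SL2Z.mul_00 γ⁻¹ η, SL2Z.mul_10 γ⁻¹ η, SL2Z.inv_00, SL2Z.inv_01, SL2Z.inv_10, SL2Z.inv_11]
    push_cast
    rw [pow_zero]
    calc _ = _ := by congr 1; ring
      _ ≤ _ := k2
      _ = _ := by ring
  · rw [SL2Z.mul_01 γ⁻¹ η, SL2Z.mul_11 γ⁻¹ η, SL2Z.inv_00, SL2Z.inv_01, SL2Z.inv_10, SL2Z.inv_11]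
    push_cast
    rw [pow_zero]
    calc _ = _ := by congr 1; ring
      _ ≤ _ := k4
      _ = _ := by ring

lemma one_le_tsum_factor {i : ℕ} {γ : SL2Z} {R S : ℝ} (hR : 1 ≤ R) (hS : 1 ≤ S)
    (h : qf (4 ^ i) (γ 0 0) (γ 1 0) + qf (4 ^ i) (γ 0 1) (γ 1 1) ≤ R * S) :
    1 ≤ ∑' k : ℕ, ENNReal.ofReal ((1 / 4) ^ k) * ∑' δ : SL2Z,
      ind (InBox i k (16 * R) δ) * ind (InBox 0 k (16 * S) (γ⁻¹ * δ)) := by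
  obtain ⟨k, δ, hδ⟩ := exists_factor hR hS h
  refine le_trans ?_ (ENNReal.le_tsum k)
  have h1 : ((4 ^ k : ℕ) : ℝ≥0∞) ≤ ∑' δ : SL2Z,
      ind (InBox i k (16 * R) δ) * ind (InBox 0 k (16 * S) (γ⁻¹ * δ)) := by
    have hinj : Function.Injective fun n : Fin (4 ^ k) => δ * unip (n : ℕ) := by
      intro m n hmn
      have := congrArg (fun η : SL2Z => η 0 1) (mul_left_cancel hmn)
      simp only [unip_01] at this
      exact Fin.ext (by exact_mod_cast this)
    calc ((4 ^ k : ℕ) : ℝ≥0∞) = ∑' n : Fin (4 ^ k), 1 := by simp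
      _ ≤ ∑' n : Fin (4 ^ k), ind (InBox i k (16 * R) (δ * unip (n : ℕ))) *
          ind (InBox 0 k (16 * S) (γ⁻¹ * (δ * unip (n : ℕ)))) := by
          refine ENNReal.tsum_le_tsum fun n => ?_
          obtain ⟨h1, h2⟩ := hδ n n.2
          rw [ind_of h1, ind_of h2, one_mul]
      _ ≤ _ := ENNReal.tsum_comp_le_tsum_of_injective hinj
          (fun η => ind (InBox i k (16 * R) η) * ind (InBox 0 k (16 * S) (γ⁻¹ * η)))
  refine le_trans (le_of_eq ?_) (mul_le_mul_right h1 _)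
  rw [← ENNReal.ofReal_natCast, ← ENNReal.ofReal_mul (by positivity)]
  push_cast
  rw [← mul_pow]
  norm_num

lemma mul_le_weighted_sq (a b : ℝ≥0∞) {l : ℝ≥0∞} (h0 : l ≠ 0) (h1 : l ≠ ⊤) :
    a * b ≤ l * (a * a) + l⁻¹ * (b * b) := by
  rcases le_total b (l * a) with h | h
  · calc a * b ≤ a * (l * a) := by gcongr
      _ = l * (a * a) := by ring
      _ ≤ _ := le_self_add
  · have h2 : a ≤ l⁻¹ * b := by
      rw [mul_comm, ← div_eq_mul_inv, ENNReal.le_div_iff_mul_le (Or.inl h0) (Or.inl h1), mul_comm]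
      exact h
    calc a * b ≤ l⁻¹ * b * b := by gcongr
      _ = l⁻¹ * (b * b) := by ring
      _ ≤ _ := le_add_self

section Correlation

variable {G X : Type*} [Group G] [MulAction G X]

lemma tsum_correlation (g : G) (w w' : G → ℝ≥0∞) :
    ∑' δ, ∑' δ', w δ * w' δ' * ∑' z : X, ind ((g * δ) • z = δ' • z) =
    ∑' z : X, ∑' y : X, (∑' δ, w δ * ind (δ • z = g⁻¹ • y)) * ∑' δ', w' δ' * ind (δ' • z = y) := by
  have h1 : ∀ (δ δ' : G) (z : X), ind ((g * δ) • z = δ' • z) =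
      ∑' y : X, ind (δ • z = g⁻¹ • y) * ind (δ' • z = y) := by
    intro δ δ' z
    rw [tsum_eq_single (δ' • z)]
    · rw [ind_of (rfl : δ' • z = δ' • z), mul_one]
      apply ind_congr
      rw [eq_inv_smul_iff, mul_smul]
    · intro y hy
      rw [ind_of_not hy.symm, mul_zero]
  simp only [h1, ← ENNReal.tsum_mul_left, ← ENNReal.tsum_mul_right]
  have h2 : ∀ δ : G, ∑' δ' : G, ∑' z : X, ∑' y : X,
      w δ * w' δ' * (ind (δ • z = g⁻¹ • y) * ind (δ' • z = y)) =
      ∑' z : X, ∑' y : X, ∑' δ' : G,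
        w δ * w' δ' * (ind (δ • z = g⁻¹ • y) * ind (δ' • z = y)) := by
    intro δ
    rw [ENNReal.tsum_comm]
    exact tsum_congr fun z => ENNReal.tsum_comm
  simp only [h2]
  rw [ENNReal.tsum_comm]
  refine tsum_congr fun z => ?_
  rw [ENNReal.tsum_comm]
  refine tsum_congr fun y => ?_
  rw [ENNReal.tsum_comm]
  exact tsum_congr fun δ' => tsum_congr fun δ => by ring

/-- A Cauchy-Schwarz inequality for numbers of coincidences of group elements acting on a set. -/
lemma tsum_coincidence_le (g : G) (w w' : G → ℝ≥0∞) {l : ℝ≥0∞} (h0 : l ≠ 0) (h1 : l ≠ ⊤) :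
    ∑' δ, ∑' δ', w δ * w' δ' * ∑' z : X, ind ((g * δ) • z = δ' • z) ≤
    l * (∑' δ, ∑' δ', w δ * w δ' * ∑' z : X, ind (δ • z = δ' • z)) +
    l⁻¹ * ∑' δ, ∑' δ', w' δ * w' δ' * ∑' z : X, ind (δ • z = δ' • z) := by
  have e : ∀ u : G → ℝ≥0∞, ∑' δ, ∑' δ', u δ * u δ' * ∑' z : X, ind (δ • z = δ' • z) =
      ∑' z : X, ∑' y : X, (∑' δ, u δ * ind (δ • z = y)) * ∑' δ', u δ' * ind (δ' • z = y) := by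
    intro u
    have := tsum_correlation (X := X) (1 : G) u u
    simpa only [one_mul, inv_one, one_smul] using this
  have e2 : ∀ z : X, ∑' y : X, (∑' δ, w δ * ind (δ • z = y)) * ∑' δ', w δ' * ind (δ' • z = y) =
      ∑' y : X, (∑' δ, w δ * ind (δ • z = g⁻¹ • y)) * ∑' δ', w δ' * ind (δ' • z = g⁻¹ • y) := by
    intro z
    rw [← (MulAction.toPerm g⁻¹ : Equiv.Perm X).tsum_eq]
    rfl
  rw [tsum_correlation, e w, tsum_congr e2, e w']
  simp only [← ENNReal.tsum_mul_left (a := l), ← ENNReal.tsum_mul_left (a := l⁻¹),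
    ← ENNReal.tsum_add]
  refine ENNReal.tsum_le_tsum fun z => ENNReal.tsum_le_tsum fun y => ?_
  exact mul_le_weighted_sq _ _ h0 h1

lemma tsum_coincidence_eq (w : G → ℝ≥0∞) :
    ∑' δ, ∑' δ', w δ * w δ' * ∑' z : X, ind (δ • z = δ' • z) =
    ∑' γ : G, (∑' z : X, ind (γ • z = z)) * ∑' δ, w δ * w (γ⁻¹ * δ) := by
  have h1 : ∀ δ : G, ∑' δ', w δ * w δ' * ∑' z : X, ind (δ • z = δ' • z) =
      ∑' γ : G, (∑' z : X, ind (γ • z = z)) * (w δ * w (γ⁻¹ * δ)) := by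
    intro δ
    rw [← ((Equiv.inv G).trans (Equiv.mulRight δ)).tsum_eq]
    refine tsum_congr fun γ => ?_
    simp only [Equiv.trans_apply, Equiv.inv_apply, Equiv.coe_mulRight]
    rw [mul_comm]
    congr 1
    rw [← (MulAction.toPerm δ : Equiv.Perm X).tsum_eq (fun z => ind (γ • z = z))]
    refine tsum_congr fun z => ind_congr ?_
    rw [MulAction.toPerm_apply, mul_smul, eq_inv_smul_iff]
  simp only [h1]
  rw [ENNReal.tsum_comm]
  simp only [ENNReal.tsum_mul_left]

end Correlation

/-- Squared Frobenius norm as a real number. -/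
def frobSq (γ : SL2Z) : ℝ := qf 1 (γ 0 0) (γ 1 0) + qf 1 (γ 0 1) (γ 1 1)

/-- Squared norm of `γ` after conjugation by a diagonal matrix. -/
def conjSq (i : ℕ) (γ : SL2Z) : ℝ :=
  (γ 0 0 : ℝ) ^ 2 + (γ 1 1 : ℝ) ^ 2 + (γ 0 1 : ℝ) ^ 2 / 16 ^ i + 16 ^ i * (γ 1 0 : ℝ) ^ 2

section Chain

variable (X : Type*) [MulAction SL2Z X]

/-- Number of fixed points. -/
def fixCount (γ : SL2Z) : ℝ≥0∞ := ∑' z : X, ind (γ • z = z)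

/-- Weighted number of coincidences of pairs of matrices in skew boxes. -/
def energy (i : ℕ) (Z : ℝ) : ℝ≥0∞ :=
  ∑' k : ℕ, ENNReal.ofReal ((1 / 4) ^ k) * ∑' δ : SL2Z, ∑' δ' : SL2Z,
    ind (InBox i k Z δ) * ind (InBox i k Z δ') * ∑' z : X, ind (δ • z = δ' • z)

lemma tsum_box_fixCount_le (g : SL2Z) (i : ℕ) {U : ℝ} (hU : 1 ≤ U) {l : ℝ≥0∞} (h0 : l ≠ 0)
    (h1 : l ≠ ⊤) :
    ∑' γ : SL2Z, ind (InBox 0 i (16 * U ^ 2) γ⁻¹) * fixCount X (g * γ) ≤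
      l * energy X i (96 * U) + l⁻¹ * energy X 0 (96 * U) := by
  have step1 : ∀ γ : SL2Z, ind (InBox 0 i (16 * U ^ 2) γ⁻¹) * fixCount X (g * γ) ≤
      ∑' k : ℕ, ENNReal.ofReal ((1 / 4) ^ k) * ∑' δ : SL2Z,
        ind (InBox i k (96 * U) δ) * ind (InBox 0 k (96 * U) (γ⁻¹ * δ)) * fixCount X (g * γ) := by
    intro γ
    apply ind_mul_le
    rintro ⟨h2, h3⟩
    have h4 := one_le_tsum_factor (i := i) (γ := γ) (R := 6 * U) (S := 6 * U)
      (by linarith) (by linarith) ?_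
    · rw [show 16 * (6 * U) = 96 * U by ring] at h4
      calc fixCount X (g * γ) = 1 * fixCount X (g * γ) := (one_mul _).symm
        _ ≤ _ := mul_le_mul_left h4 _
        _ = _ := by
          simp only [← ENNReal.tsum_mul_right, mul_assoc]
    · rw [SL2Z.inv_00, SL2Z.inv_10] at h2
      rw [SL2Z.inv_01, SL2Z.inv_11] at h3
      unfold qf at *
      push_cast at h2 h3
      simp only [pow_zero, div_one, one_mul, neg_sq] at h2 h3
      have e : (γ 0 0 : ℝ) ^ 2 / 4 ^ i + 4 ^ i * (γ 1 0 : ℝ) ^ 2 +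
          ((γ 0 1 : ℝ) ^ 2 / 4 ^ i + 4 ^ i * (γ 1 1 : ℝ) ^ 2) =
          4 ^ i * ((γ 1 1 : ℝ) ^ 2 + (γ 1 0 : ℝ) ^ 2) +
          ((γ 0 1 : ℝ) ^ 2 + (γ 0 0 : ℝ) ^ 2) / 4 ^ i := by
        ring
      rw [e]
      rw [le_div_iff₀' (by positivity)] at h2
      rw [← div_le_iff₀ (by positivity)] at h3
      nlinarith
  refine (ENNReal.tsum_le_tsum step1).trans ?_
  rw [ENNReal.tsum_comm]
  unfold energy
  simp only [ENNReal.tsum_mul_left]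
  rw [← ENNReal.tsum_mul_left (a := l), ← ENNReal.tsum_mul_left (a := l⁻¹),
    ← ENNReal.tsum_add]
  refine ENNReal.tsum_le_tsum fun k => ?_
  rw [mul_left_comm l, mul_left_comm l⁻¹, ← mul_add]
  refine mul_le_mul_right ?_ _
  refine le_trans (le_of_eq ?_) (tsum_coincidence_le (X := X) g
    (fun δ => ind (InBox i k (96 * U) δ))
    (fun δ => ind (InBox 0 k (96 * U) δ)) h0 h1)
  rw [ENNReal.tsum_comm]
  refine tsum_congr fun δ => ?_
  rw [← ((Equiv.inv SL2Z).trans (Equiv.mulLeft δ)).tsum_eq]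
  refine tsum_congr fun δ' => ?_
  simp only [Equiv.trans_apply, Equiv.inv_apply, Equiv.coe_mulLeft, _root_.mul_inv_rev, inv_inv,
    inv_mul_cancel_right]
  congr 1
  unfold fixCount
  rw [← (MulAction.toPerm δ' : Equiv.Perm X).tsum_eq]
  refine tsum_congr fun z => ind_congr ?_
  rw [MulAction.toPerm_apply, ← mul_smul, mul_assoc, inv_mul_cancel_right]

lemma tsum_fixCount_le {U V : ℝ} (hU : 1 ≤ U) (hV : 1 ≤ V) :
    ∑' γ : SL2Z, ind (frobSq γ ≤ V ^ 2 * U ^ 2) * fixCount X γ ≤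
    ENNReal.ofReal (3712 * V ^ 2) * ∑' i : ℕ, ENNReal.ofReal ((1 / 4) ^ i) *
      (ENNReal.ofReal ((1 / 2) ^ i) * energy X i (96 * U) +
        ENNReal.ofReal (2 ^ i) * energy X 0 (96 * U)) := by
  have step1 : ∀ γ : SL2Z, ind (frobSq γ ≤ V ^ 2 * U ^ 2) * fixCount X γ ≤
      ∑' i : ℕ, ENNReal.ofReal ((1 / 4) ^ i) * ∑' δ : SL2Z,
        ind (InBox 0 i (16 * V ^ 2) δ) * ind (InBox 0 i (16 * U ^ 2) (γ⁻¹ * δ)) *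
          fixCount X γ := by
    intro γ
    apply ind_mul_le
    intro h
    have h4 := one_le_tsum_factor (i := 0) (γ := γ) (R := V ^ 2) (S := U ^ 2)
      (one_le_pow₀ hV) (one_le_pow₀ hU) (by simpa [frobSq] using h)
    calc fixCount X γ = 1 * fixCount X γ := (one_mul _).symm
      _ ≤ _ := mul_le_mul_left h4 _
      _ = _ := by
        simp only [← ENNReal.tsum_mul_right, mul_assoc]
  refine (ENNReal.tsum_le_tsum step1).trans ?_
  rw [ENNReal.tsum_comm]
  simp only [ENNReal.tsum_mul_left]
  rw [← ENNReal.tsum_mul_left]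
  refine ENNReal.tsum_le_tsum fun i => ?_
  rw [mul_left_comm]
  refine mul_le_mul_right ?_ _
  rw [ENNReal.tsum_comm]
  have step2 : ∀ δ : SL2Z, ∑' γ : SL2Z, ind (InBox 0 i (16 * V ^ 2) δ) *
      ind (InBox 0 i (16 * U ^ 2) (γ⁻¹ * δ)) * fixCount X γ ≤
      ind (InBox 0 i (16 * V ^ 2) δ) * (ENNReal.ofReal ((1 / 2) ^ i) * energy X i (96 * U) +
        ENNReal.ofReal (2 ^ i) * energy X 0 (96 * U)) := by
    intro δ
    simp only [mul_assoc, ENNReal.tsum_mul_left]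
    refine mul_le_mul_right ?_ _
    rw [← (Equiv.mulLeft δ).tsum_eq]
    have h2 := tsum_box_fixCount_le X δ i hU (l := ENNReal.ofReal ((1 / 2) ^ i))
      (by rw [Ne, ENNReal.ofReal_eq_zero, not_le]; positivity) ENNReal.ofReal_ne_top
    rw [← ENNReal.ofReal_inv_of_pos (by positivity), one_div, ← inv_pow, inv_inv] at h2
    simpa [mul_assoc] using h2
  refine (ENNReal.tsum_le_tsum step2).trans ?_
  rw [ENNReal.tsum_mul_right]
  refine mul_le_mul_left ?_ _
  have h3 := skew_box_one_le (X := 16 * V ^ 2) (β := 4 ^ i) (by positivity)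
    (one_le_pow₀ (by norm_num))
  rw [show 232 * (16 * V ^ 2) = 3712 * V ^ 2 by ring] at h3
  refine le_trans (ENNReal.tsum_le_tsum fun δ => ind_mono ?_) h3
  rintro ⟨h4, h5⟩
  constructor
  · simpa [qf, qv] using h4
  · simpa [qf, qv] using h5

lemma qv_mul_qv (A B C x y z w : ℝ) :
    qv A B C x y * qv A B C z w = (A * x * z + B * (x * w + y * z) + C * y * w) ^ 2 +
      (A * C - B ^ 2) * (x * w - y * z) ^ 2 := by
  unfold qv; ring

lemma tsum_box_pair_le (i : ℕ) {Z : ℝ} (hZ : 0 < Z) (γ : SL2Z) :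
    ∑' k : ℕ, ENNReal.ofReal ((1 / 4) ^ k) * ∑' δ : SL2Z,
      ind (InBox i k Z δ) * ind (InBox i k Z (γ⁻¹ * δ)) ≤
    ind (2 + conjSq i γ ≤ 4 * Z ^ 2) * ENNReal.ofReal (2000 * (Z / √(2 + conjSq i γ))) := by
  have hα : (0 : ℝ) < 4 ^ i := by positivity
  have h16 : (16 : ℝ) ^ i = (4 ^ i) ^ 2 := by rw [← pow_mul, mul_comm, pow_mul]; norm_num
  have hdet : (γ 0 0 : ℝ) * γ 1 1 - γ 0 1 * γ 1 0 = 1 := by exact_mod_cast γ.det_eq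
  have hN : 0 ≤ conjSq i γ := by unfold conjSq; positivity
  have hconj : conjSq i γ = (γ 0 0 : ℝ) ^ 2 + (γ 1 1 : ℝ) ^ 2 + (γ 0 1 : ℝ) ^ 2 / (4 ^ i) ^ 2 +
    (4 ^ i) ^ 2 * (γ 1 0 : ℝ) ^ 2 := by rw [conjSq, h16]
  set α : ℝ := 4 ^ i with hαdef
  set A : ℝ := 1 / α + (γ 1 1 : ℝ) ^ 2 / α + α * (γ 1 0 : ℝ) ^ 2 with hA
  set B : ℝ := -(γ 0 1 * γ 1 1 / α + α * γ 0 0 * γ 1 0) with hB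
  set C : ℝ := α + (γ 0 1 : ℝ) ^ 2 / α + α * (γ 0 0 : ℝ) ^ 2 with hC
  have hA0 : 0 < A := by positivity
  have hD : A * C - B ^ 2 = 2 + conjSq i γ := by
    have h1 : A * C - B ^ 2 = 1 + ((γ 0 0 : ℝ) * γ 1 1 - γ 0 1 * γ 1 0) ^ 2 + conjSq i γ := by
      rw [hconj, hA, hB, hC]
      field_simp
      ring
    rw [h1, hdet]; norm_num
  have hQ : ∀ x y : ℝ, qv A B C x y =
      qf α x y + qf α (γ 1 1 * x - γ 0 1 * y) (-γ 1 0 * x + γ 0 0 * y) := by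
    intro x y
    rw [hA, hB, hC]
    unfold qv qf
    field_simp
    ring
  have hbox : ∀ k δ, InBox i k Z δ ∧ InBox i k Z (γ⁻¹ * δ) →
      qv A B C (δ 0 0) (δ 1 0) ≤ (2 * Z) / 4 ^ k ∧ qv A B C (δ 0 1) (δ 1 1) ≤ (2 * Z) * 4 ^ k := by
    rintro k δ ⟨⟨h1, h2⟩, h3, h4⟩
    rw [SL2Z.mul_00 γ⁻¹ δ, SL2Z.mul_10 γ⁻¹ δ, SL2Z.inv_00, SL2Z.inv_01, SL2Z.inv_10,
      SL2Z.inv_11] at h3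
    rw [SL2Z.mul_01 γ⁻¹ δ, SL2Z.mul_11 γ⁻¹ δ, SL2Z.inv_00, SL2Z.inv_01, SL2Z.inv_10,
      SL2Z.inv_11] at h4
    push_cast at h3 h4
    rw [neg_mul, ← sub_eq_add_neg] at h3 h4
    rw [hQ, hQ, mul_div_assoc]
    constructor <;> linarith
  by_cases hc : 2 + conjSq i γ ≤ 4 * Z ^ 2
  · rw [ind_of hc, one_mul]
    have h1 := tsum_skew_box_le (A := A) (B := B) (C := C) (X := 2 * Z) hA0
      (by rw [hD]; positivity) (by positivity)
    rw [hD] at h1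
    refine le_trans (ENNReal.tsum_le_tsum fun k => mul_le_mul_right
      (ENNReal.tsum_le_tsum fun δ => ?_) _) (h1.trans (le_of_eq ?_))
    · rw [ind_mul_ind]
      exact ind_mono (hbox k δ)
    · congr 1; ring
  · rw [ind_of_not hc, zero_mul, nonpos_iff_eq_zero, ENNReal.tsum_eq_zero]
    intro k
    rw [mul_eq_zero, ENNReal.tsum_eq_zero]
    right
    intro δ
    rw [ind_mul_ind]
    apply ind_of_not
    intro h
    obtain ⟨h1, h2⟩ := hbox k δ h
    have hdδ : (δ 0 0 : ℝ) * δ 1 1 - δ 0 1 * δ 1 0 = 1 := by exact_mod_cast δ.det_eq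
    have h3 := qv_mul_qv A B C (δ 0 0) (δ 1 0) (δ 0 1) (δ 1 1)
    rw [hD, show (δ 0 0 : ℝ) * δ 1 1 - δ 1 0 * δ 0 1 = 1 by linarith] at h3
    have h4 : 0 ≤ qv A B C (δ 0 1) (δ 1 1) := by
      rw [hQ]; exact add_nonneg (qf_nonneg hα _ _) (qf_nonneg hα _ _)
    have h5 : qv A B C (δ 0 0) (δ 1 0) * qv A B C (δ 0 1) (δ 1 1) ≤
        (2 * Z) / 4 ^ k * ((2 * Z) * 4 ^ k) := by gcongr
    have h6 : (2 * Z) / 4 ^ k * ((2 * Z) * 4 ^ k) = 4 * Z ^ 2 := by field_simp; ring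
    apply hc
    nlinarith [sq_nonneg (A * δ 0 0 * δ 0 1 + B * (δ 0 0 * δ 1 1 + δ 1 0 * δ 0 1) +
      C * δ 1 0 * δ 1 1)]

lemma energy_le (i : ℕ) {Z : ℝ} (hZ : 0 < Z) :
    energy X i Z ≤ ∑' γ : SL2Z, fixCount X γ *
      (ind (2 + conjSq i γ ≤ 4 * Z ^ 2) * ENNReal.ofReal (2000 * (Z / √(2 + conjSq i γ)))) := by
  unfold energy
  simp only [fun k => tsum_coincidence_eq (X := X) (fun δ => ind (InBox i k Z δ)),
    ← ENNReal.tsum_mul_left (a := ENNReal.ofReal _)]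
  rw [ENNReal.tsum_comm]
  refine ENNReal.tsum_le_tsum fun γ => ?_
  simp only [mul_left_comm (ENNReal.ofReal _), ENNReal.tsum_mul_left]
  refine mul_le_mul_right ?_ _
  refine le_trans (le_of_eq ?_) (tsum_box_pair_le i hZ γ)
  simp only

end Chain

/-- Pairs of residue classes modulo `q`, with the linear action of `SL(2,ℤ)`. -/
structure ModPair (q : ℕ) where
  /-- First coordinate. -/
  x : ZMod q
  /-- Second coordinate. -/
  y : ZMod q

lemma ModPair.ext' {q : ℕ} {v w : ModPair q} (h1 : v.x = w.x) (h2 : v.y = w.y) : v = w := by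
  cases v; cases w; simp_all

/-- Pairs of residue classes as a product. -/
def ModPair.equiv (q : ℕ) : ZMod q × ZMod q ≃ ModPair q where
  toFun v := ⟨v.1, v.2⟩
  invFun v := (v.x, v.y)
  left_inv _ := rfl
  right_inv _ := rfl

instance ModPair.instMulAction (q : ℕ) : MulAction SL2Z (ModPair q) where
  smul γ v := ⟨(γ 0 0 : ℤ) * v.x + (γ 0 1 : ℤ) * v.y, (γ 1 0 : ℤ) * v.x + (γ 1 1 : ℤ) * v.y⟩
  one_smul v := by
    apply ModPair.ext'
    · change (((1 : SL2Z) 0 0 : ℤ) : ZMod q) * v.x + (((1 : SL2Z) 0 1 : ℤ) : ZMod q) * v.y = v.x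
      simp
    · change (((1 : SL2Z) 1 0 : ℤ) : ZMod q) * v.x + (((1 : SL2Z) 1 1 : ℤ) : ZMod q) * v.y = v.y
      simp
  mul_smul γ δ v := by
    apply ModPair.ext'
    · change (((γ * δ) 0 0 : ℤ) : ZMod q) * v.x + (((γ * δ) 0 1 : ℤ) : ZMod q) * v.y =
        (γ 0 0 : ℤ) * ((δ 0 0 : ℤ) * v.x + (δ 0 1 : ℤ) * v.y) +
          (γ 0 1 : ℤ) * ((δ 1 0 : ℤ) * v.x + (δ 1 1 : ℤ) * v.y)
      rw [SL2Z.mul_00, SL2Z.mul_01]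
      push_cast
      ring
    · change (((γ * δ) 1 0 : ℤ) : ZMod q) * v.x + (((γ * δ) 1 1 : ℤ) : ZMod q) * v.y =
        (γ 1 0 : ℤ) * ((δ 0 0 : ℤ) * v.x + (δ 0 1 : ℤ) * v.y) +
          (γ 1 1 : ℤ) * ((δ 1 0 : ℤ) * v.x + (δ 1 1 : ℤ) * v.y)
      rw [SL2Z.mul_10, SL2Z.mul_11]
      push_cast
      ring

lemma ModPair.smul_eq_iff {q : ℕ} (γ : SL2Z) (v : ModPair q) : γ • v = v ↔
    ((γ 0 0 - 1 : ℤ) : ZMod q) * v.x + ((γ 0 1 : ℤ) : ZMod q) * v.y = 0 ∧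
    ((γ 1 0 : ℤ) : ZMod q) * v.x + ((γ 1 1 - 1 : ℤ) : ZMod q) * v.y = 0 := by
  have h : γ • v = ⟨(γ 0 0 : ℤ) * v.x + (γ 0 1 : ℤ) * v.y,
    (γ 1 0 : ℤ) * v.x + (γ 1 1 : ℤ) * v.y⟩ := rfl
  rw [h]
  push_cast
  constructor
  · intro h1
    have h2 := congrArg ModPair.x h1
    have h3 := congrArg ModPair.y h1
    dsimp only at h2 h3
    exact ⟨by linear_combination h2, by linear_combination h3⟩
  · rintro ⟨h2, h3⟩
    apply ModPair.ext'
    · dsimp only; linear_combination h2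
    · dsimp only; linear_combination h3

lemma fixCount_eq {q : ℕ} (γ : SL2Z) : fixCount (ModPair q) γ =
    ∑' x : ZMod q, ∑' y : ZMod q, ind
      (((γ 0 0 - 1 : ℤ) : ZMod q) * x + ((γ 0 1 : ℤ) : ZMod q) * y = 0 ∧
      ((γ 1 0 : ℤ) : ZMod q) * x + ((γ 1 1 - 1 : ℤ) : ZMod q) * y = 0) := by
  unfold fixCount
  rw [← (ModPair.equiv q).tsum_eq, ← ENNReal.tsum_prod
    (f := fun x y : ZMod q => ind (((γ 0 0 - 1 : ℤ) : ZMod q) * x + ((γ 0 1 : ℤ) : ZMod q) * y = 0 ∧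
      ((γ 1 0 : ℤ) : ZMod q) * x + ((γ 1 1 - 1 : ℤ) : ZMod q) * y = 0))]
  exact tsum_congr fun v => ind_congr (ModPair.smul_eq_iff γ _)

lemma tsum_ind_eq_card {α : Type*} [Fintype α] (P : α → Prop) [DecidablePred P] :
    ∑' a, ind (P a) = ((Finset.univ.filter P).card : ℝ≥0∞) := by
  rw [tsum_fintype, Finset.card_filter]
  push_cast
  refine Finset.sum_congr rfl fun a _ => ?_
  by_cases h : P a <;> simp [ind, h]

lemma tsum_ind_mul_eq_zero_le {q : ℕ} [NeZero q] (m : ℤ) :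
    ∑' z : ZMod q, ind ((m : ZMod q) * z = 0) ≤ (Int.gcd m q : ℝ≥0∞) := by
  classical
  set g := Int.gcd m q
  have hg : 0 < g := Int.gcd_pos_of_ne_zero_right _ (by exact_mod_cast NeZero.ne q)
  calc _ ≤ ∑' z : ZMod q, ind (g • z = 0) := by
        refine ENNReal.tsum_le_tsum fun z => ind_mono fun h => ?_
        have h1 : (((g : ℤ)) : ZMod q) = ((m * Int.gcdA m q + q * Int.gcdB m q : ℤ) : ZMod q) := by
          congr 1
          exact Int.gcd_eq_gcd_ab m q
        rw [nsmul_eq_mul]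
        push_cast at h1
        rw [h1, ZMod.natCast_self, zero_mul, add_zero]
        linear_combination (Int.gcdA m q : ZMod q) * h
    _ = _ := tsum_ind_eq_card _
    _ ≤ _ := by
        exact Nat.cast_le.2 (IsAddCyclic.card_nsmul_eq_zero_le (α := ZMod q) hg)

lemma tsum_line_le {p e : ℕ} [Fact p.Prime] (he : e ≤ 2) (K : ZMod (p ^ 2) → ZMod (p ^ 2) → Prop)
    (m₁ m₂ n : ℤ) (hm : ¬(p : ℤ) ∣ m₁)
    (h1 : ∀ x y, K x y →
      (p : ZMod (p ^ 2)) ^ e * ((m₁ : ZMod (p ^ 2)) * x + (m₂ : ZMod (p ^ 2)) * y) = 0)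
    (h2 : ∀ x y, K x y → (p : ZMod (p ^ 2)) ^ e * ((n : ZMod (p ^ 2)) * y) = 0) :
    ∑' y, ∑' x, ind (K x y) ≤ (Int.gcd (p ^ (2 * e) * n) (p ^ 4) : ℝ≥0∞) := by
  have hp : p.Prime := Fact.out
  have : NeZero (p ^ 2) := ⟨pow_ne_zero _ hp.ne_zero⟩
  have hunit : IsUnit (m₁ : ZMod (p ^ 2)) := by
    rw [ZMod.coe_int_isUnit_iff_isCoprime]
    have : IsCoprime (p : ℤ) m₁ := (Nat.prime_iff_prime_int.1 hp).coprime_iff_not_dvd.2 hm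
    push_cast
    exact this.pow_left
  have inner : ∀ y, ∑' x, ind (K x y) ≤
      ind (((p ^ e * n : ℤ) : ZMod (p ^ 2)) * y = 0) * ((p ^ e : ℕ) : ℝ≥0∞) := by
    intro y
    by_cases hex : ∃ x0, K x0 y
    · obtain ⟨x0, hx0⟩ := hex
      rw [ind_of (by push_cast; rw [mul_assoc]; exact h2 x0 y hx0), one_mul]
      have h3 : Int.gcd ((p ^ e : ℕ) : ℤ) (p ^ 2 : ℕ) = p ^ e := by
        rw [Int.gcd_natCast_natCast]
        exact Nat.gcd_eq_left (pow_dvd_pow _ he)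
      have h4 := tsum_ind_mul_eq_zero_le (q := p ^ 2) ((p ^ e : ℕ) : ℤ)
      rw [h3] at h4
      refine le_trans ?_ h4
      rw [← (Equiv.subRight x0).tsum_eq (fun z => ind ((((p ^ e : ℕ) : ℤ) : ZMod (p ^ 2)) * z = 0))]
      refine ENNReal.tsum_le_tsum fun x => ind_mono fun hx => ?_
      have h5 := h1 x y hx
      have h6 := h1 x0 y hx0
      rw [Equiv.subRight_apply]
      rw [← hunit.mul_right_eq_zero]
      push_cast
      linear_combination h5 - h6
    · push Not at hex
      have : ∀ x, ind (K x y) = 0 := fun x => ind_of_not (hex x)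
      simp [this]
  calc _ ≤ _ := ENNReal.tsum_le_tsum inner
    _ = (∑' y, ind (((p ^ e * n : ℤ) : ZMod (p ^ 2)) * y = 0)) * ((p ^ e : ℕ) : ℝ≥0∞) :=
        ENNReal.tsum_mul_right
    _ ≤ (Int.gcd (p ^ e * n) (p ^ 2 : ℕ) : ℝ≥0∞) * ((p ^ e : ℕ) : ℝ≥0∞) :=
        mul_le_mul_left (tsum_ind_mul_eq_zero_le _) _
    _ ≤ _ := by
        norm_cast
        have e1 : Int.gcd (p ^ e * n) (p ^ 2 : ℕ) * p ^ e =
            Int.gcd (p ^ (2 * e) * n) (p ^ (2 + e)) := by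
          have := Int.gcd_mul_left ((p ^ e : ℕ) : ℤ) (p ^ e * n) (p ^ 2 : ℕ)
          rw [Int.natAbs_natCast] at this
          rw [mul_comm, ← this]
          push_cast
          congr 1 <;> ring
        push_cast at e1 ⊢
        rw [e1]
        apply Nat.le_of_dvd (Int.gcd_pos_of_ne_zero_right _
          (by exact_mod_cast pow_ne_zero _ hp.ne_zero))
        apply Int.gcd_dvd_gcd_of_dvd_right
        exact pow_dvd_pow _ (by omega)

lemma tsum_kernel_le {p e : ℕ} [Fact p.Prime] (he : e ≤ 2) (m₁ m₂ m₃ m₄ : ℤ)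
    (hm : ¬((p : ℤ) ∣ m₁ ∧ (p : ℤ) ∣ m₂ ∧ (p : ℤ) ∣ m₃ ∧ (p : ℤ) ∣ m₄)) :
    ∑' x : ZMod (p ^ 2), ∑' y : ZMod (p ^ 2), ind
      ((p : ZMod (p ^ 2)) ^ e * ((m₁ : ZMod (p ^ 2)) * x + (m₂ : ZMod (p ^ 2)) * y) = 0 ∧
      (p : ZMod (p ^ 2)) ^ e * ((m₃ : ZMod (p ^ 2)) * x + (m₄ : ZMod (p ^ 2)) * y) = 0) ≤
    (Int.gcd (p ^ (2 * e) * (m₁ * m₄ - m₂ * m₃)) (p ^ 4) : ℝ≥0∞) := by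
  set K : ZMod (p ^ 2) → ZMod (p ^ 2) → Prop := fun x y =>
    (p : ZMod (p ^ 2)) ^ e * ((m₁ : ZMod (p ^ 2)) * x + (m₂ : ZMod (p ^ 2)) * y) = 0 ∧
      (p : ZMod (p ^ 2)) ^ e * ((m₃ : ZMod (p ^ 2)) * x + (m₄ : ZMod (p ^ 2)) * y) = 0
  have hy : ∀ x y, K x y →
      (p : ZMod (p ^ 2)) ^ e * (((m₁ * m₄ - m₂ * m₃ : ℤ) : ZMod (p ^ 2)) * y) = 0 := by
    rintro x y ⟨h1, h2⟩
    push_cast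
    linear_combination (m₁ : ZMod (p ^ 2)) * h2 - (m₃ : ZMod (p ^ 2)) * h1
  have hx : ∀ x y, K x y →
      (p : ZMod (p ^ 2)) ^ e * (((m₁ * m₄ - m₂ * m₃ : ℤ) : ZMod (p ^ 2)) * x) = 0 := by
    rintro x y ⟨h1, h2⟩
    push_cast
    linear_combination (m₄ : ZMod (p ^ 2)) * h1 - (m₂ : ZMod (p ^ 2)) * h2
  by_cases h1 : (p : ℤ) ∣ m₁
  swap
  · rw [ENNReal.tsum_comm]
    exact tsum_line_le he K m₁ m₂ _ h1 (fun x y h => h.1) hy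
  by_cases h2 : (p : ℤ) ∣ m₂
  swap
  · exact tsum_line_le he (fun y x => K x y) m₂ m₁ _ h2
      (fun y x h => by linear_combination h.1) (fun y x h => hx x y h)
  by_cases h3 : (p : ℤ) ∣ m₃
  swap
  · rw [ENNReal.tsum_comm]
    exact tsum_line_le he K m₃ m₄ _ h3 (fun x y h => h.2) hy
  by_cases h4 : (p : ℤ) ∣ m₄
  swap
  · exact tsum_line_le he (fun y x => K x y) m₄ m₃ _ h4
      (fun y x h => by linear_combination h.2) (fun y x h => hx x y h)
  exact absurd ⟨h1, h2, h3, h4⟩ hm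

lemma det_sub_one (γ : SL2Z) :
    (γ 0 0 - 1) * (γ 1 1 - 1) - γ 0 1 * γ 1 0 = 2 - trZ γ := by
  unfold trZ
  linear_combination γ.det_eq

lemma fixCount_le_gcd {p : ℕ} [Fact p.Prime] (γ : SL2Z) :
    fixCount (ModPair (p ^ 2)) γ ≤ (Int.gcd (2 - trZ γ) (p ^ 4) : ℝ≥0∞) := by
  have hp : p.Prime := Fact.out
  have : NeZero (p ^ 2) := ⟨pow_ne_zero _ hp.ne_zero⟩
  rw [fixCount_eq, ← det_sub_one]
  generalize γ 0 0 - 1 = m₁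
  generalize γ 1 1 - 1 = m₄
  generalize γ 0 1 = m₂
  generalize γ 1 0 = m₃
  by_cases h1 : (p : ℤ) ∣ m₁ ∧ (p : ℤ) ∣ m₂ ∧ (p : ℤ) ∣ m₃ ∧ (p : ℤ) ∣ m₄
  swap
  · have := tsum_kernel_le (e := 0) (by norm_num) m₁ m₂ m₃ m₄ h1
    simpa using this
  obtain ⟨⟨m₁, rfl⟩, ⟨m₂, rfl⟩, ⟨m₃, rfl⟩, m₄, rfl⟩ := h1
  by_cases h2 : (p : ℤ) ∣ m₁ ∧ (p : ℤ) ∣ m₂ ∧ (p : ℤ) ∣ m₃ ∧ (p : ℤ) ∣ m₄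
  swap
  · have := tsum_kernel_le (e := 1) (by norm_num) m₁ m₂ m₃ m₄ h2
    push_cast
    rw [show (p : ℤ) ^ (2 * 1) * (m₁ * m₄ - m₂ * m₃) = p * m₁ * (p * m₄) - p * m₂ * (p * m₃) by
      ring] at this
    simpa only [pow_one, mul_add, ← mul_assoc] using this
  obtain ⟨⟨m₁, rfl⟩, ⟨m₂, rfl⟩, ⟨m₃, rfl⟩, m₄, rfl⟩ := h2
  have h3 : Int.gcd ((p : ℤ) * (p * m₁) * (p * (p * m₄)) - p * (p * m₂) * (p * (p * m₃))) (p ^ 4) =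
      p ^ 4 := by
    have : (p : ℤ) * (p * m₁) * (p * (p * m₄)) - p * (p * m₂) * (p * (p * m₃)) =
      p ^ 4 * (m₁ * m₄ - m₂ * m₃) := by ring
    rw [this, Int.gcd_eq_natAbs, Nat.gcd_eq_right] <;> simp [Int.natAbs_mul, Int.natAbs_pow]
  rw [h3]
  calc _ ≤ ∑' x : ZMod (p ^ 2), ∑' y : ZMod (p ^ 2), (1 : ℝ≥0∞) :=
        ENNReal.tsum_le_tsum fun x => ENNReal.tsum_le_tsum fun y => ind_le_one _
    _ = _ := by
        simp only [tsum_fintype, Finset.sum_const, Finset.card_univ, ZMod.card, nsmul_eq_mul]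
        push_cast
        ring

lemma card_le_fixCount {q : ℕ} {γ : SL2Z} {ι : Type*} [Fintype ι] {n : ℕ}
    (hn : Fintype.card ι = n) (f : ι → ModPair q)
    (hf : Function.Injective f) (h : ∀ i, γ • f i = f i) :
    (n : ℝ≥0∞) ≤ fixCount (ModPair q) γ := by
  subst hn
  calc (Fintype.card ι : ℝ≥0∞) = ∑' i : ι, ind (γ • f i = f i) := by
        rw [tsum_congr fun i => ind_of (h i)]
        simp
    _ ≤ _ := ENNReal.tsum_comp_le_tsum_of_injective hf (fun v => ind (γ • v = v))

lemma le_fixCount {p : ℕ} [Fact p.Prime] (γ : SL2Z) (h : (p : ℤ) ^ 2 ∣ 2 - trZ γ) :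
    ((p ^ 2 : ℕ) : ℝ≥0∞) ≤ fixCount (ModPair (p ^ 2)) γ := by
  have hp : p.Prime := Fact.out
  have : NeZero (p ^ 2) := ⟨pow_ne_zero _ hp.ne_zero⟩
  have hdet : ((γ 0 0 - 1 : ℤ) : ZMod (p ^ 2)) * ((γ 1 1 - 1 : ℤ) : ZMod (p ^ 2)) -
      ((γ 0 1 : ℤ) : ZMod (p ^ 2)) * ((γ 1 0 : ℤ) : ZMod (p ^ 2)) = 0 := by
    rw [← Int.cast_mul, ← Int.cast_mul, ← Int.cast_sub, det_sub_one,
      ZMod.intCast_zmod_eq_zero_iff_dvd]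
    exact_mod_cast h
  have hunit : ∀ m : ℤ, ¬(p : ℤ) ∣ m → IsUnit (m : ZMod (p ^ 2)) := by
    intro m hm
    rw [ZMod.coe_int_isUnit_iff_isCoprime]
    have : IsCoprime (p : ℤ) m := (Nat.prime_iff_prime_int.1 hp).coprime_iff_not_dvd.2 hm
    push_cast
    exact this.pow_left
  have inj : ∀ m₁ m₂ : ℤ, ¬((p : ℤ) ∣ m₁ ∧ (p : ℤ) ∣ m₂) →
      Function.Injective fun z : ZMod (p ^ 2) =>
        (⟨(m₂ : ZMod (p ^ 2)) * z, -((m₁ : ZMod (p ^ 2)) * z)⟩ : ModPair (p ^ 2)) := by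
    intro m₁ m₂ hm z w hzw
    simp only [ModPair.mk.injEq, neg_inj] at hzw
    by_cases h1 : (p : ℤ) ∣ m₁
    · exact (hunit m₂ fun h2 => hm ⟨h1, h2⟩).mul_left_cancel hzw.1
    · exact (hunit m₁ h1).mul_left_cancel hzw.2
  by_cases h1 : (p : ℤ) ∣ γ 0 0 - 1 ∧ (p : ℤ) ∣ γ 0 1
  swap
  · refine card_le_fixCount (ZMod.card _) (fun z : ZMod (p ^ 2) =>
      (⟨((γ 0 1 : ℤ) : ZMod (p ^ 2)) * z,
      -(((γ 0 0 - 1 : ℤ) : ZMod (p ^ 2)) * z)⟩ : ModPair (p ^ 2))) (inj _ _ h1) fun z =>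
      (ModPair.smul_eq_iff _ _).2 ⟨by ring, ?_⟩
    linear_combination -z * hdet
  by_cases h2 : (p : ℤ) ∣ γ 1 0 ∧ (p : ℤ) ∣ γ 1 1 - 1
  swap
  · refine card_le_fixCount (ZMod.card _) (fun z : ZMod (p ^ 2) =>
      (⟨((γ 1 1 - 1 : ℤ) : ZMod (p ^ 2)) * z,
      -(((γ 1 0 : ℤ) : ZMod (p ^ 2)) * z)⟩ : ModPair (p ^ 2))) (inj _ _ h2) fun z =>
      (ModPair.smul_eq_iff _ _).2 ⟨?_, by ring⟩
    linear_combination z * hdet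
  have hpp : (p : ZMod (p ^ 2)) * p = 0 := by
    rw [← sq]; exact_mod_cast ZMod.natCast_self (p ^ 2)
  have hz : ∀ m : ℤ, (p : ℤ) ∣ m → (m : ZMod (p ^ 2)) * p = 0 := by
    rintro _ ⟨k, rfl⟩
    push_cast
    linear_combination (k : ZMod (p ^ 2)) * hpp
  have hinj : ∀ a b : Fin p, (p : ZMod (p ^ 2)) * ((a : ℕ) : ZMod (p ^ 2)) =
      p * ((b : ℕ) : ZMod (p ^ 2)) → a = b := by
    intro a b hab
    rw [← Nat.cast_mul, ← Nat.cast_mul, ZMod.natCast_eq_natCast_iff, sq] at hab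
    have := Nat.ModEq.mul_left_cancel' hp.ne_zero hab
    exact Fin.ext (Nat.ModEq.eq_of_lt_of_lt this a.2 b.2)
  refine card_le_fixCount (by simp [sq]) (fun ab : Fin p × Fin p =>
    (⟨p * ((ab.1 : ℕ) : ZMod (p ^ 2)), p * ((ab.2 : ℕ) : ZMod (p ^ 2))⟩ : ModPair (p ^ 2))) ?_ ?_
  · rintro ⟨a, b⟩ ⟨a', b'⟩ hab
    simp only [ModPair.mk.injEq] at hab
    rw [hinj _ _ hab.1, hinj _ _ hab.2]
  · rintro ⟨a, b⟩
    rw [ModPair.smul_eq_iff]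
    dsimp only
    constructor
    · linear_combination ((a : ℕ) : ZMod (p ^ 2)) * hz _ h1.1 +
        ((b : ℕ) : ZMod (p ^ 2)) * hz _ h1.2
    · linear_combination ((a : ℕ) : ZMod (p ^ 2)) * hz _ h2.1 +
        ((b : ℕ) : ZMod (p ^ 2)) * hz _ h2.2

lemma succ_pow_le_mul_two_pow {k : ℕ} (hk : 0 < k) (e : ℕ) : (e + 1) ^ k ≤ k ^ k * 2 ^ e := by
  have h1 : e + 1 ≤ k * 2 ^ (e / k) := by
    calc e + 1 ≤ k * (e / k + 1) := Nat.lt_mul_div_succ e hk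
      _ ≤ _ := Nat.mul_le_mul_left _ Nat.lt_two_pow_self
  calc (e + 1) ^ k ≤ (k * 2 ^ (e / k)) ^ k := Nat.pow_le_pow_left h1 _
    _ = k ^ k * 2 ^ (e / k * k) := by rw [mul_pow, ← pow_mul]
    _ ≤ _ := Nat.mul_le_mul_left _ (Nat.pow_le_pow_right (by norm_num) (Nat.div_mul_le_self _ _))

/-- The divisor bound: the number of divisors of `n` is `O(n ^ (1 / k))` for every `k`. -/
lemma card_divisors_pow_le {k : ℕ} (hk : 0 < k) {n : ℕ} (hn : n ≠ 0) :
    n.divisors.card ^ k ≤ (k ^ k) ^ 2 ^ k * n := by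
  have hB : 1 ≤ k ^ k := Nat.one_le_pow _ _ hk
  have hf : ∏ p ∈ n.primeFactors, p ^ n.factorization p = n := Nat.prod_factorization_pow_eq_self hn
  rw [Nat.card_divisors hn, ← Finset.prod_pow]
  calc ∏ p ∈ n.primeFactors, (n.factorization p + 1) ^ k
      ≤ ∏ p ∈ n.primeFactors, (if p < 2 ^ k then k ^ k else 1) * p ^ n.factorization p := by
        refine Finset.prod_le_prod' fun p hp => ?_
        have hp2 : 2 ≤ p := (Nat.prime_of_mem_primeFactors hp).two_le
        split_ifs with h
        · exact (succ_pow_le_mul_two_pow hk _).trans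
            (Nat.mul_le_mul_left _ (Nat.pow_le_pow_left hp2 _))
        · rw [one_mul]
          calc (n.factorization p + 1) ^ k ≤ (2 ^ n.factorization p) ^ k :=
                Nat.pow_le_pow_left Nat.lt_two_pow_self _
            _ = (2 ^ k) ^ n.factorization p := by rw [← pow_mul, mul_comm, pow_mul]
            _ ≤ _ := Nat.pow_le_pow_left (not_lt.1 h) _
    _ = (k ^ k) ^ (n.primeFactors.filter (· < 2 ^ k)).card * n := by
        rw [Finset.prod_mul_distrib, hf, Finset.prod_ite, Finset.prod_const_one, mul_one,
          Finset.prod_const]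
    _ ≤ _ := by
        refine Nat.mul_le_mul_right _ (Nat.pow_le_pow_right hB ?_)
        calc _ ≤ (Finset.range (2 ^ k)).card :=
              Finset.card_le_card fun p hp => Finset.mem_range.2 (Finset.mem_filter.1 hp).2
          _ = _ := Finset.card_range _

lemma tsum_ind_dvd_le {n : ℤ} (hn : n ≠ 0) :
    ∑' b : ℤ, ind (b ∣ n) ≤ 2 * (n.natAbs.divisors.card : ℝ≥0∞) := by
  have h := tsum_natAbs_le (fun m => ind (m ∈ n.natAbs.divisors))
  have h2 : ∑' m : ℕ, ind (m ∈ n.natAbs.divisors) = (n.natAbs.divisors.card : ℝ≥0∞) := by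
    rw [tsum_eq_sum (s := n.natAbs.divisors) fun m hm => ind_of_not hm,
      Finset.sum_congr rfl fun m hm => ind_of hm]
    simp
  rw [h2] at h
  refine le_trans (ENNReal.tsum_le_tsum fun b => ind_mono fun hb => ?_) h
  exact Nat.mem_divisors.2 ⟨Int.natAbs_dvd_natAbs.2 hb, Int.natAbs_ne_zero.2 hn⟩

lemma exists_divisor_bound : ∃ C : ℝ, 0 < C ∧ ∀ L : ℝ, 1 ≤ L → ∀ n : ℤ, n ≠ 0 →
    |(n : ℝ)| ≤ 2 * L ^ 2 → ∑' b : ℤ, ind (b ∣ n) ≤ ENNReal.ofReal (C * L ^ (1 / 8 : ℝ)) := by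
  set B : ℝ := (((16 ^ 16) ^ 2 ^ 16 : ℕ) : ℝ) with hB
  have hB0 : 0 ≤ B := Nat.cast_nonneg _
  refine ⟨2 * (2 * (B + 1)), by positivity, fun L hL n hn hnL => (tsum_ind_dvd_le hn).trans ?_⟩
  have hL0 : 0 ≤ L := by linarith
  set d := n.natAbs.divisors.card with hd
  have h1 : (d : ℝ) ^ 16 ≤ B * |(n : ℝ)| := by
    rw [← natAbs_cast_real, hB]
    exact_mod_cast card_divisors_pow_le (k := 16) (by norm_num) (Int.natAbs_ne_zero.2 hn)
  have hx : (L ^ (1 / 8 : ℝ)) ^ 16 = L ^ 2 := by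
    rw [← Real.rpow_natCast, ← Real.rpow_mul hL0]
    norm_num
  have h2 : (d : ℝ) ≤ 2 * (B + 1) * L ^ (1 / 8 : ℝ) := by
    refine le_of_pow_le_pow_left₀ (n := 16) (by norm_num) (by positivity) ?_
    have hBp : B ≤ (B + 1) ^ 16 :=
      (by linarith : B ≤ B + 1).trans (le_self_pow₀ (by linarith) (by norm_num))
    calc (d : ℝ) ^ 16 ≤ B * |(n : ℝ)| := h1
      _ ≤ (B + 1) ^ 16 * (2 * L ^ 2) := by gcongr
      _ ≤ (B + 1) ^ 16 * (2 ^ 16 * L ^ 2) := by gcongr; norm_num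
      _ = _ := by rw [mul_pow, mul_pow, hx]; ring
  rw [← ENNReal.ofReal_natCast, ← ENNReal.ofReal_ofNat, ← ENNReal.ofReal_mul (by norm_num)]
  exact ENNReal.ofReal_le_ofReal (by linarith)

/-- A matrix with nonzero off-diagonal product is determined by its diagonal and a divisor. -/
lemma exists_tsum_diag_le : ∃ C : ℝ, 0 < C ∧ ∀ L : ℝ, 1 ≤ L → ∀ g : ℤ → ℤ → ℝ≥0∞,
    ∑' γ : SL2Z, ind (γ 0 1 * γ 1 0 ≠ 0 ∧ |(γ 0 0 : ℝ)| ≤ L ∧ |(γ 1 1 : ℝ)| ≤ L) *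
        g (γ 0 0) (γ 1 1) ≤
      ENNReal.ofReal (C * L ^ (1 / 8 : ℝ)) *
        ∑' a : ℤ, ∑' d : ℤ, ind (|(a : ℝ)| ≤ L ∧ |(d : ℝ)| ≤ L) * g a d := by
  obtain ⟨C, hC, hdiv⟩ := exists_divisor_bound
  refine ⟨C, hC, fun L hL g => ?_⟩
  calc _ ≤ ∑' v : (ℤ × ℤ) × ℤ, ind (v.1.1 * v.1.2 - 1 ≠ 0 ∧ v.2 ∣ v.1.1 * v.1.2 - 1) *
        (ind (|(v.1.1 : ℝ)| ≤ L ∧ |(v.1.2 : ℝ)| ≤ L) * g v.1.1 v.1.2) := by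
        refine tsum_ind_le_of_injOn (fun γ : SL2Z => ((γ 0 0, γ 1 1), γ 0 1)) _ _ ?_ ?_
        · rintro γ δ ⟨h1, -⟩ - h
          simp only [Prod.mk.injEq] at h
          obtain ⟨⟨ha, hd⟩, hb⟩ := h
          refine SL2Z.ext_entries ha hb ?_ hd
          have e1 := γ.det_eq
          have e2 := δ.det_eq
          rw [← ha, ← hb, ← hd] at e2
          exact mul_left_cancel₀ (left_ne_zero_of_mul h1) (by linarith)
        · rintro γ ⟨h1, h2⟩
          have e : γ 0 0 * γ 1 1 - 1 = γ 0 1 * γ 1 0 := by linarith [γ.det_eq]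
          dsimp only
          rw [e, ind_of ⟨h1, dvd_mul_right _ _⟩, ind_of h2, one_mul, one_mul]
    _ = ∑' a : ℤ, ∑' d : ℤ, (∑' b : ℤ, ind (a * d - 1 ≠ 0 ∧ b ∣ a * d - 1)) *
        (ind (|(a : ℝ)| ≤ L ∧ |(d : ℝ)| ≤ L) * g a d) := by
        rw [ENNReal.tsum_prod' , ENNReal.tsum_prod']
        simp only [ENNReal.tsum_mul_right]
    _ ≤ ∑' a : ℤ, ∑' d : ℤ, ENNReal.ofReal (C * L ^ (1 / 8 : ℝ)) *
        (ind (|(a : ℝ)| ≤ L ∧ |(d : ℝ)| ≤ L) * g a d) := by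
        refine ENNReal.tsum_le_tsum fun a => ENNReal.tsum_le_tsum fun d => ?_
        by_cases hP : |(a : ℝ)| ≤ L ∧ |(d : ℝ)| ≤ L
        swap
        · simp [ind_of_not hP]
        gcongr
        by_cases h0 : a * d - 1 = 0
        · simp [h0, ind]
        refine le_trans (ENNReal.tsum_le_tsum fun b => ind_mono fun h => h.2) (hdiv L hL _ h0 ?_)
        push_cast
        calc |(a : ℝ) * d - 1| ≤ |(a : ℝ)| * |(d : ℝ)| + 1 := by
              rw [← abs_mul]; simpa using abs_sub ((a : ℝ) * d) 1
          _ ≤ L * L + 1 := by gcongr; exacts [hP.1, hP.2]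
          _ ≤ _ := by nlinarith
    _ = _ := by simp only [ENNReal.tsum_mul_left]

lemma tsum_gcd_le {p : ℕ} (hp : p.Prime) (k : ℕ) {Y : ℝ} (hY : 0 ≤ Y) :
    ∑' t : ℤ, ind (|(t : ℝ)| ≤ Y) * (Int.gcd t (p ^ k) : ℝ≥0∞) ≤
      ENNReal.ofReal ((k + 1) * (2 * Y + 2 * p ^ k)) := by
  have hp1 : (1 : ℝ) ≤ p := by exact_mod_cast hp.one_lt.le
  have hgcd : ∀ t : ℤ, (Int.gcd t (p ^ k) : ℝ≥0∞) ≤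
      ∑ j ∈ Finset.range (k + 1), ind ((p : ℤ) ^ j ∣ t) * (p : ℝ≥0∞) ^ j := by
    intro t
    have h1 : Int.gcd t (p ^ k) ∣ p ^ k := by
      have := Int.gcd_dvd_natAbs_right t ((p : ℤ) ^ k)
      rwa [Int.natAbs_pow, Int.natAbs_natCast] at this
    obtain ⟨j, hj, hjk⟩ := (Nat.dvd_prime_pow hp).1 h1
    have h2 : (p : ℤ) ^ j ∣ t := by
      have := Int.gcd_dvd_left t ((p : ℤ) ^ k)
      rw [hjk] at this
      exact_mod_cast this
    refine le_trans ?_ (Finset.single_le_sum (fun _ _ => zero_le)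
      (Finset.mem_range.2 (Nat.lt_succ_of_le hj)))
    rw [ind_of h2, one_mul, hjk]
    push_cast
    exact le_rfl
  have hterm : ∀ j ∈ Finset.range (k + 1),
      ∑' t : ℤ, ind (|(t : ℝ)| ≤ Y) * (ind ((p : ℤ) ^ j ∣ t) * (p : ℝ≥0∞) ^ j) ≤
        ENNReal.ofReal (2 * Y + 2 * p ^ k) := by
    intro j hj
    have hj' : j ≤ k := Nat.lt_succ_iff.1 (Finset.mem_range.1 hj)
    have hpj : (0 : ℝ) < (p : ℝ) ^ j := by positivity
    have hpz : (p : ℤ) ^ j ≠ 0 := pow_ne_zero _ (by exact_mod_cast hp.ne_zero)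
    calc _ = ∑' t : ℤ, ind (|(t : ℝ)| ≤ Y ∧ (p : ℤ) ^ j ∣ t) * (p : ℝ≥0∞) ^ j := by
          simp only [← mul_assoc, ind_mul_ind]
      _ ≤ ∑' s : ℤ, ind (|(s : ℝ)| ≤ Y / p ^ j) * (p : ℝ≥0∞) ^ j := by
          refine tsum_ind_le_of_injOn (fun t : ℤ => t / (p : ℤ) ^ j) _ _ ?_ ?_
          · rintro s t ⟨-, h1⟩ ⟨-, h2⟩ h
            exact (Int.ediv_left_inj h1 h2).1 h
          · rintro _ ⟨h1, ⟨s, rfl⟩⟩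
            rw [Int.mul_ediv_cancel_left _ hpz, ind_of, one_mul]
            rw [le_div_iff₀ hpj]
            push_cast at h1
            rwa [abs_mul, abs_of_pos hpj, mul_comm] at h1
      _ ≤ ENNReal.ofReal (2 * (Y / p ^ j) + 2) * (p : ℝ≥0∞) ^ j := by
          rw [ENNReal.tsum_mul_right]
          gcongr
          exact tsum_int_abs_le (by positivity)
      _ = ENNReal.ofReal (2 * Y + 2 * p ^ j) := by
          rw [← ENNReal.ofReal_natCast, ← ENNReal.ofReal_pow (by positivity),
            ← ENNReal.ofReal_mul (by positivity)]
          congr 1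
          field_simp
      _ ≤ _ := by gcongr
  calc _ ≤ ∑' t : ℤ, ∑ j ∈ Finset.range (k + 1),
        ind (|(t : ℝ)| ≤ Y) * (ind ((p : ℤ) ^ j ∣ t) * (p : ℝ≥0∞) ^ j) := by
        refine ENNReal.tsum_le_tsum fun t => ?_
        rw [← Finset.mul_sum]
        gcongr
        exact hgcd t
    _ = ∑ j ∈ Finset.range (k + 1),
        ∑' t : ℤ, ind (|(t : ℝ)| ≤ Y) * (ind ((p : ℤ) ^ j ∣ t) * (p : ℝ≥0∞) ^ j) :=
        Summable.tsum_finsetSum fun _ _ => ENNReal.summable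
    _ ≤ ∑ j ∈ Finset.range (k + 1), ENNReal.ofReal (2 * Y + 2 * p ^ k) :=
        Finset.sum_le_sum hterm
    _ = _ := by
        rw [Finset.sum_const, Finset.card_range, nsmul_eq_mul, ENNReal.ofReal_mul (by positivity)]
        congr 1
        rw [← Nat.cast_succ, ENNReal.ofReal_natCast]

lemma log_le_mul_rpow {L : ℝ} (hL : 1 ≤ L) : 4 + 2 * Real.log L ≤ 36 * L ^ (1 / 16 : ℝ) := by
  have h1 := Real.log_le_rpow_div (x := L) (by linarith) (ε := 1 / 16) (by norm_num)
  have h2 : 1 ≤ L ^ (1 / 16 : ℝ) := Real.one_le_rpow hL (by norm_num)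
  linarith

lemma tsum_weight_le {L Z : ℝ} (hL : 1 ≤ L) (hZ : 0 ≤ Z) (i : ℕ) :
    ∑' t : ℤ, ind (|(t : ℝ)| ≤ 4 ^ i * L) * ENNReal.ofReal (Z / max |(t : ℝ)| 1) ≤
      ENNReal.ofReal (Z * (72 * (3 / 2) ^ i * L ^ (1 / 16 : ℝ))) := by
  have h4 : (1 : ℝ) ≤ 4 ^ i := one_le_pow₀ (by norm_num)
  have hx : 1 ≤ 4 ^ i * L := by nlinarith
  have h2 : 1 ≤ L ^ (1 / 16 : ℝ) := Real.one_le_rpow hL (by norm_num)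
  calc _ = ENNReal.ofReal Z *
        ∑' t : ℤ, ind (|(t : ℝ)| ≤ 4 ^ i * L) * ENNReal.ofReal (1 / max |(t : ℝ)| 1) := by
        rw [← ENNReal.tsum_mul_left]
        refine tsum_congr fun t => ?_
        rw [mul_left_comm, ← ENNReal.ofReal_mul hZ, mul_one_div]
    _ ≤ ENNReal.ofReal Z * ENNReal.ofReal (4 + 2 * Real.log (4 ^ i * L)) := by
        gcongr
        exact tsum_int_inv_le hx
    _ ≤ _ := by
        rw [← ENNReal.ofReal_mul hZ]
        refine ENNReal.ofReal_le_ofReal (mul_le_mul_of_nonneg_left ?_ hZ)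
        rw [Real.log_mul (by positivity) (by positivity), Real.log_pow]
        have h5 : Real.log 4 ≤ 2 := by
          rw [show (4 : ℝ) = 2 ^ 2 by norm_num, Real.log_pow]
          have := Real.log_two_lt_d9
          push_cast
          linarith
        have h6 : (1 : ℝ) + i / 2 ≤ (3 / 2) ^ i := by
          have := one_add_mul_le_pow (a := (1 / 2 : ℝ)) (by norm_num) i
          norm_num at this ⊢
          linarith
        have h7 := log_le_mul_rpow hL
        have h8 : (0 : ℝ) ≤ i := Nat.cast_nonneg _
        calc 4 + 2 * (i * Real.log 4 + Real.log L) ≤ 36 * L ^ (1 / 16 : ℝ) + 4 * i := by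
              nlinarith
          _ ≤ 72 * (1 + i / 2) * L ^ (1 / 16 : ℝ) := by nlinarith
          _ ≤ _ := by gcongr

/-- Sum over matrices with nonzero off-diagonal product in the energy bound. -/
lemma exists_tsum_gcd_weight_le : ∃ C : ℝ, 0 < C ∧ ∀ p : ℕ, p.Prime → ∀ k : ℕ, ∀ L Z : ℝ,
    (p : ℝ) ^ k ≤ L → 1 ≤ L → 0 ≤ Z →
    ∑' γ : SL2Z, ind (γ 0 1 * γ 1 0 ≠ 0 ∧ |(γ 0 0 : ℝ)| ≤ L ∧ |(γ 1 1 : ℝ)| ≤ L) *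
        ((Int.gcd (2 - trZ γ) (p ^ k) : ℝ≥0∞) * ENNReal.ofReal (Z / max |(γ 0 0 : ℝ)| 1)) ≤
      ENNReal.ofReal (C * (k + 1) * Z * L * L ^ (3 / 16 : ℝ)) := by
  obtain ⟨C, hC, hD⟩ := exists_tsum_diag_le
  refine ⟨C * 720, by positivity, fun p hp k L Z hpL hL hZ => ?_⟩
  have h := hD L hL fun a d =>
    (Int.gcd (2 - (a + d)) (p ^ k) : ℝ≥0∞) * ENNReal.ofReal (Z / max |(a : ℝ)| 1)
  refine h.trans ?_
  have hinner : ∀ a : ℤ, |(a : ℝ)| ≤ L →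
      ∑' d : ℤ, ind (|(d : ℝ)| ≤ L) * (Int.gcd (2 - (a + d)) (p ^ k) : ℝ≥0∞) ≤
        ENNReal.ofReal ((k + 1) * (10 * L)) := by
    intro a ha
    calc _ ≤ ∑' d : ℤ, ind (|((2 - a - d : ℤ) : ℝ)| ≤ 4 * L) *
          (Int.gcd (2 - a - d) (p ^ k) : ℝ≥0∞) := by
          refine ENNReal.tsum_le_tsum fun d => ?_
          rw [show 2 - (a + d) = 2 - a - d by ring]
          gcongr
          refine ind_mono fun hd => ?_
          push_cast
          rw [abs_le] at ha hd ⊢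
          constructor <;> linarith
      _ = ∑' t : ℤ, ind (|(t : ℝ)| ≤ 4 * L) * (Int.gcd t (p ^ k) : ℝ≥0∞) :=
          (Equiv.subLeft (2 - a)).tsum_eq
            (fun t : ℤ => ind (|(t : ℝ)| ≤ 4 * L) * (Int.gcd t (p ^ k) : ℝ≥0∞))
      _ ≤ ENNReal.ofReal ((k + 1) * (2 * (4 * L) + 2 * p ^ k)) := tsum_gcd_le hp k (by linarith)
      _ ≤ _ := by gcongr; linarith
  have hsum : ∑' a : ℤ, ∑' d : ℤ, ind (|(a : ℝ)| ≤ L ∧ |(d : ℝ)| ≤ L) *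
      ((Int.gcd (2 - (a + d)) (p ^ k) : ℝ≥0∞) * ENNReal.ofReal (Z / max |(a : ℝ)| 1)) ≤
      ENNReal.ofReal ((k + 1) * (10 * L)) * ENNReal.ofReal (Z * (72 * L ^ (1 / 16 : ℝ))) := by
    calc _ = ∑' a : ℤ, ind (|(a : ℝ)| ≤ L) *
          ((∑' d : ℤ, ind (|(d : ℝ)| ≤ L) * (Int.gcd (2 - (a + d)) (p ^ k) : ℝ≥0∞)) *
            ENNReal.ofReal (Z / max |(a : ℝ)| 1)) := by
          refine tsum_congr fun a => ?_
          rw [← ENNReal.tsum_mul_right, ← ENNReal.tsum_mul_left]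
          refine tsum_congr fun d => ?_
          rw [← ind_mul_ind]
          ring
      _ ≤ ∑' a : ℤ, ind (|(a : ℝ)| ≤ L) * (ENNReal.ofReal ((k + 1) * (10 * L)) *
            ENNReal.ofReal (Z / max |(a : ℝ)| 1)) := by
          refine ENNReal.tsum_le_tsum fun a => ind_mul_le_ind_mul fun ha => ?_
          gcongr
          exact hinner a ha
      _ = ENNReal.ofReal ((k + 1) * (10 * L)) *
          ∑' a : ℤ, ind (|(a : ℝ)| ≤ L) * ENNReal.ofReal (Z / max |(a : ℝ)| 1) := by
          rw [← ENNReal.tsum_mul_left]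
          exact tsum_congr fun a => mul_left_comm _ _ _
      _ ≤ _ := by
          gcongr
          simpa using tsum_weight_le hL hZ 0
  refine (mul_le_mul_right hsum _).trans ?_
  rw [← ENNReal.ofReal_mul (by positivity), ← ENNReal.ofReal_mul (by positivity)]
  refine ENNReal.ofReal_le_ofReal (le_of_eq ?_)
  have : L ^ (3 / 16 : ℝ) = L ^ (1 / 8 : ℝ) * L ^ (1 / 16 : ℝ) := by
    rw [← Real.rpow_add (by linarith)]
    norm_num
  rw [this]
  ring

lemma tsum_upper_le (H : ℤ → ℝ≥0∞) :
    ∑' γ : SL2Z, ind (γ 1 0 = 0) * H (γ 0 1) ≤ 4 * ∑' t, H t := by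
  calc _ ≤ ∑' v : ℤ × ℤ, ind (|(v.1 : ℝ)| ≤ 1) * H v.2 := by
        have hunit : ∀ γ : SL2Z, γ 1 0 = 0 → γ 0 0 * γ 1 1 = 1 := fun γ h => by
          have := γ.det_eq
          rw [h] at this
          linarith
        refine tsum_ind_le_of_injOn (fun γ : SL2Z => (γ 0 0, γ 0 1)) _ _ ?_ ?_
        · intro γ δ h1 h2 h
          simp only [Prod.mk.injEq] at h
          refine SL2Z.ext_entries h.1 h.2 (h1.trans h2.symm) ?_
          refine mul_left_cancel₀ (left_ne_zero_of_mul_eq_one (hunit γ h1)) ?_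
          rw [hunit γ h1, h.1, hunit δ h2]
        · intro γ h1
          dsimp only
          rw [ind_of, one_mul]
          rcases Int.isUnit_iff.1 (IsUnit.of_mul_eq_one _ (hunit γ h1)) with h | h <;> simp [h]
    _ = (∑' a : ℤ, ind (|(a : ℝ)| ≤ 1)) * ∑' t, H t :=
        tsum_prod_mul (fun a : ℤ => ind (|(a : ℝ)| ≤ 1)) H
    _ ≤ _ := by gcongr; exact tsum_int_abs_le_one

lemma tsum_lower_le (H : ℤ → ℝ≥0∞) :
    ∑' γ : SL2Z, ind (γ 0 1 = 0) * H (γ 1 0) ≤ 4 * ∑' t, H t := by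
  calc _ ≤ ∑' v : ℤ × ℤ, ind (|(v.1 : ℝ)| ≤ 1) * H v.2 := by
        have hunit : ∀ γ : SL2Z, γ 0 1 = 0 → γ 0 0 * γ 1 1 = 1 := fun γ h => by
          have := γ.det_eq
          rw [h] at this
          linarith
        refine tsum_ind_le_of_injOn (fun γ : SL2Z => (γ 0 0, γ 1 0)) _ _ ?_ ?_
        · intro γ δ h1 h2 h
          simp only [Prod.mk.injEq] at h
          refine SL2Z.ext_entries h.1 (h1.trans h2.symm) h.2 ?_
          refine mul_left_cancel₀ (left_ne_zero_of_mul_eq_one (hunit γ h1)) ?_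
          rw [hunit γ h1, h.1, hunit δ h2]
        · intro γ h1
          dsimp only
          rw [ind_of, one_mul]
          rcases Int.isUnit_iff.1 (IsUnit.of_mul_eq_one _ (hunit γ h1)) with h | h <;> simp [h]
    _ = (∑' a : ℤ, ind (|(a : ℝ)| ≤ 1)) * ∑' t, H t :=
        tsum_prod_mul (fun a : ℤ => ind (|(a : ℝ)| ≤ 1)) H
    _ ≤ _ := by gcongr; exact tsum_int_abs_le_one

lemma max_abs_one_le_sqrt {x y : ℝ} (h : x ^ 2 + 1 ≤ y) : max |x| 1 ≤ √y :=
  max_le (Real.abs_le_sqrt (by linarith)) (Real.one_le_sqrt.2 (by nlinarith [sq_nonneg x]))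

lemma gcd_pow_le {p k : ℕ} (hp : p.Prime) (t : ℤ) :
    (Int.gcd t (p ^ k) : ℝ≥0∞) ≤ ENNReal.ofReal (p ^ k) := by
  have h1 : Int.gcd t (p ^ k) ≤ p ^ k := by
    refine Nat.le_of_dvd (pow_pos hp.pos _) ?_
    have := Int.gcd_dvd_natAbs_right t ((p : ℤ) ^ k)
    rwa [Int.natAbs_pow, Int.natAbs_natCast] at this
  rw [← ENNReal.ofReal_natCast]
  exact ENNReal.ofReal_le_ofReal (by exact_mod_cast h1)

/-- Pointwise bound for the summand in `energy_le`. -/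
lemma energy_term_le {p : ℕ} [hp : Fact p.Prime] (i : ℕ) {Z : ℝ} (hZ : 0 < Z) (γ : SL2Z) :
    fixCount (ModPair (p ^ 2)) γ * (ind (2 + conjSq i γ ≤ 4 * Z ^ 2) *
        ENNReal.ofReal (2000 * (Z / √(2 + conjSq i γ)))) ≤
      ind (γ 0 1 * γ 1 0 ≠ 0 ∧ |(γ 0 0 : ℝ)| ≤ 2 * Z ∧ |(γ 1 1 : ℝ)| ≤ 2 * Z) *
        ((Int.gcd (2 - trZ γ) (p ^ 4) : ℝ≥0∞) *
          ENNReal.ofReal (2000 * Z / max |(γ 0 0 : ℝ)| 1)) +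
      (ind (γ 1 0 = 0) * (ind (|(γ 0 1 : ℝ)| ≤ 4 ^ i * (2 * Z)) *
        ENNReal.ofReal (4 ^ i * (2000 * Z) / max |(γ 0 1 : ℝ)| 1)) * ENNReal.ofReal (p ^ 4) +
      ind (γ 0 1 = 0) * (ind (|(γ 1 0 : ℝ)| ≤ 4 ^ i * (2 * Z)) *
        ENNReal.ofReal (4 ^ i * (2000 * Z) / max |(γ 1 0 : ℝ)| 1)) * ENNReal.ofReal (p ^ 4)) := by
  have h4 : (1 : ℝ) ≤ 4 ^ i := one_le_pow₀ (by norm_num)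
  have h16 : (16 : ℝ) ^ i = 4 ^ i * 4 ^ i := by rw [← mul_pow]; norm_num
  have hN : conjSq i γ = (γ 0 0 : ℝ) ^ 2 + (γ 1 1 : ℝ) ^ 2 + ((γ 0 1 : ℝ) / 4 ^ i) ^ 2 +
      (4 ^ i * (γ 1 0 : ℝ)) ^ 2 := by
    unfold conjSq
    rw [h16]
    field_simp
  have hfix := fixCount_le_gcd (p := p) γ
  have hfix' := hfix.trans (gcd_pow_le hp.out _)
  set w : ℝ := 2 + conjSq i γ with hw
  rw [hN] at hw
  have sa := sq_nonneg (γ 0 0 : ℝ)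
  have sd := sq_nonneg (γ 1 1 : ℝ)
  have sb := sq_nonneg ((γ 0 1 : ℝ) / 4 ^ i)
  have sc := sq_nonneg (4 ^ i * (γ 1 0 : ℝ))
  rw [mul_left_comm]
  refine ind_mul_le fun hwZ => ?_
  have hZ2 : 4 * Z ^ 2 = (2 * Z) ^ 2 := by ring
  rw [hZ2] at hwZ
  have hw0 : 0 < w := by linarith
  have hpos : 0 < √w := Real.sqrt_pos.2 hw0
  have hb : max |(γ 0 1 : ℝ)| 1 ≤ 4 ^ i * √w := by
    have := max_abs_one_le_sqrt (x := (γ 0 1 : ℝ) / 4 ^ i) (y := w) (by linarith)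
    rw [abs_div, abs_of_pos (by positivity : (0 : ℝ) < 4 ^ i)] at this
    have h1 := (div_le_iff₀' (by positivity)).1 ((le_max_left _ _).trans this)
    have h2 := (le_max_right _ _).trans this
    exact max_le h1 (by nlinarith)
  have hc : max |(γ 1 0 : ℝ)| 1 ≤ 4 ^ i * √w := by
    have := max_abs_one_le_sqrt (x := 4 ^ i * (γ 1 0 : ℝ)) (y := w) (by linarith)
    rw [abs_mul, abs_of_pos (by positivity : (0 : ℝ) < 4 ^ i)] at this
    have h1 := (le_max_left _ _).trans this
    have h2 := (le_max_right _ _).trans this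
    have h3 := abs_nonneg (γ 1 0 : ℝ)
    exact max_le (by nlinarith) (by nlinarith)
  have hsq : √w ≤ 2 * Z := Real.sqrt_le_iff.2 ⟨by positivity, hwZ⟩
  have hdiv : ∀ x : ℝ, max |x| 1 ≤ 4 ^ i * √w →
      2000 * (Z / √w) ≤ 4 ^ i * (2000 * Z) / max |x| 1 := by
    intro x hx
    have : 0 < max |x| 1 := lt_max_of_lt_right one_pos
    rw [le_div_iff₀ this]
    calc 2000 * (Z / √w) * max |x| 1 ≤ 2000 * (Z / √w) * (4 ^ i * √w) := by gcongr
      _ = _ := by field_simp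
  by_cases hb0 : γ 0 1 = 0
  · refine le_add_left (le_add_left ?_)
    rw [ind_of hb0, ind_of, one_mul, one_mul, mul_comm]
    · gcongr
      exact hdiv _ hc
    · exact (le_max_left _ _).trans (hc.trans (by gcongr))
  by_cases hc0 : γ 1 0 = 0
  · refine le_add_left (le_add_right ?_)
    rw [ind_of hc0, ind_of, one_mul, one_mul, mul_comm]
    · gcongr
      exact hdiv _ hb
    · exact (le_max_left _ _).trans (hb.trans (by gcongr))
  refine le_add_right ?_
  rw [ind_of, one_mul]
  · gcongr
    have ha := max_abs_one_le_sqrt (x := (γ 0 0 : ℝ)) (y := w) (by linarith)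
    have : 0 < max |(γ 0 0 : ℝ)| 1 := lt_max_of_lt_right one_pos
    rw [← mul_div_assoc]
    gcongr
  · exact ⟨mul_ne_zero hb0 hc0, abs_le_of_sq_le_sq (by linarith) (by positivity),
      abs_le_of_sq_le_sq (by linarith) (by positivity)⟩

lemma exists_energy_le : ∃ C : ℝ, 0 < C ∧ ∀ p : ℕ, [Fact p.Prime] → ∀ i : ℕ,
    energy (ModPair (p ^ 2)) i (96 * (p : ℝ) ^ 4) ≤
      ENNReal.ofReal (C * 6 ^ i * ((p : ℝ) ^ 8 * (p : ℝ) ^ (3 / 4 : ℝ))) := by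
  obtain ⟨C, hC, h1⟩ := exists_tsum_gcd_weight_le
  refine ⟨(5000 * C + 576000) * 192 ^ 3, by positivity, fun p hp i => ?_⟩
  have hp1 : (1 : ℝ) ≤ p := by exact_mod_cast hp.out.one_lt.le
  have hQ1 : (1 : ℝ) ≤ (p : ℝ) ^ 4 := one_le_pow₀ hp1
  set Z : ℝ := 96 * (p : ℝ) ^ 4 with hZ
  have hZ0 : 0 < Z := by positivity
  set L : ℝ := 2 * Z with hL
  have hL1 : 1 ≤ L := by linarith
  have hQL : (p : ℝ) ^ 4 ≤ L := by linarith
  refine (energy_le _ i hZ0).trans ((ENNReal.tsum_le_tsum fun γ => energy_term_le i hZ0 γ).trans ?_)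
  rw [ENNReal.tsum_add, ENNReal.tsum_add, ENNReal.tsum_mul_right, ENNReal.tsum_mul_right]
  have e1 := h1 p hp.out 4 L (2000 * Z) hQL hL1 (by positivity)
  set H : ℤ → ℝ≥0∞ := fun t => ind (|(t : ℝ)| ≤ 4 ^ i * (2 * Z)) *
        ENNReal.ofReal (4 ^ i * (2000 * Z) / max |(t : ℝ)| 1)
  have hH : ∑' t, H t ≤ _ := tsum_weight_le hL1 (Z := 4 ^ i * (2000 * Z)) (by positivity) i
  have e2 := (tsum_upper_le H).trans (mul_le_mul_right hH 4)
  have e3 := (tsum_lower_le H).trans (mul_le_mul_right hH 4)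
  refine (add_le_add e1 (add_le_add (mul_le_mul_left e2 _) (mul_le_mul_left e3 _))).trans ?_
  rw [show (4 : ℝ≥0∞) = ENNReal.ofReal 4 by simp, ← ENNReal.ofReal_mul (by positivity),
    ← ENNReal.ofReal_mul (by positivity), ← ENNReal.ofReal_add (by positivity) (by positivity),
    ← ENNReal.ofReal_add (by positivity) (by positivity)]
  refine ENNReal.ofReal_le_ofReal ?_
  have hpw : L ^ (3 / 16 : ℝ) ≤ 192 * (p : ℝ) ^ (3 / 4 : ℝ) := by
    have : L = 192 * (p : ℝ) ^ 4 := by rw [hL, hZ]; ring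
    rw [this, Real.mul_rpow (by norm_num) (by positivity), ← Real.rpow_natCast,
      ← Real.rpow_mul (by positivity)]
    have h192 : (192 : ℝ) ^ (3 / 16 : ℝ) ≤ 192 := by
      calc (192 : ℝ) ^ (3 / 16 : ℝ) ≤ 192 ^ (1 : ℝ) :=
            Real.rpow_le_rpow_of_exponent_le (by norm_num) (by norm_num)
        _ = _ := Real.rpow_one _
    norm_num
    gcongr
  have h116 : L ^ (1 / 16 : ℝ) ≤ L ^ (3 / 16 : ℝ) :=
    Real.rpow_le_rpow_of_exponent_le hL1 (by norm_num)
  have h6 : (6 : ℝ) ^ i = 4 ^ i * (3 / 2) ^ i := by rw [← mul_pow]; norm_num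
  have h6' : (1 : ℝ) ≤ 6 ^ i := one_le_pow₀ (by norm_num)
  have hZL : Z = L / 2 := by rw [hL]; ring
  calc _ ≤ C * ((4 : ℕ) + 1) * (2000 * Z) * L * L ^ (3 / 16 : ℝ) +
        (4 * (4 ^ i * (2000 * Z) * (72 * (3 / 2) ^ i * L ^ (3 / 16 : ℝ))) * L +
          4 * (4 ^ i * (2000 * Z) * (72 * (3 / 2) ^ i * L ^ (3 / 16 : ℝ))) * L) := by gcongr
    _ = (5000 * C * 1 + 576000 * 6 ^ i) * L ^ 2 * L ^ (3 / 16 : ℝ) := by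
        rw [h6, hZL]; push_cast; ring
    _ ≤ (5000 * C * 6 ^ i + 576000 * 6 ^ i) * L ^ 2 * (192 * (p : ℝ) ^ (3 / 4 : ℝ)) := by gcongr
    _ = _ := by rw [hL, hZ]; ring

/-- Bound for matrices whose trace is close to `2` modulo `p ^ 2`, when `p` is small. -/
lemma exists_count_le_of_pow_le : ∃ C : ℝ, 0 < C ∧ ∀ p : ℕ, p.Prime → ∀ T : ℝ,
    (p : ℝ) ^ 4 ≤ T →
    ∑' γ : SL2Z, ind (frobSq γ ≤ T ^ 2 ∧ (p : ℤ) ^ 2 ∣ 2 - trZ γ) ≤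
      ENNReal.ofReal (C * T ^ 2 * (p : ℝ) ^ (-(5 / 4) : ℝ)) := by
  obtain ⟨C, hC, hE⟩ := exists_energy_le
  refine ⟨3712 * (C * 8), by positivity, fun p hp T hT => ?_⟩
  have : Fact p.Prime := ⟨hp⟩
  have hp1 : (1 : ℝ) ≤ p := by exact_mod_cast hp.one_lt.le
  have hp0 : (0 : ℝ) < p := by linarith
  have hQ1 : (1 : ℝ) ≤ (p : ℝ) ^ 4 := one_le_pow₀ hp1
  have hQ0 : (0 : ℝ) < (p : ℝ) ^ 4 := by linarith
  set R : ℝ := (p : ℝ) ^ 8 * (p : ℝ) ^ (3 / 4 : ℝ) with hR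
  have hR0 : 0 ≤ R := by positivity
  have hchain := tsum_fixCount_le (ModPair (p ^ 2)) hQ1 ((one_le_div hQ0).2 hT)
  have hVU : (T / (p : ℝ) ^ 4) ^ 2 * ((p : ℝ) ^ 4) ^ 2 = T ^ 2 := by field_simp
  rw [hVU] at hchain
  have hlow : ENNReal.ofReal ((p : ℝ) ^ 2) *
      ∑' γ : SL2Z, ind (frobSq γ ≤ T ^ 2 ∧ (p : ℤ) ^ 2 ∣ 2 - trZ γ) ≤
      ∑' γ : SL2Z, ind (frobSq γ ≤ T ^ 2) * fixCount (ModPair (p ^ 2)) γ := by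
    rw [← ENNReal.tsum_mul_left]
    refine ENNReal.tsum_le_tsum fun γ => ?_
    rw [← ind_mul_ind, mul_left_comm]
    gcongr
    rw [mul_comm]
    refine ind_mul_le fun h => le_trans (le_of_eq ?_) (le_fixCount γ h)
    rw [← ENNReal.ofReal_natCast]
    push_cast
    rfl
  have hup : ∑' i : ℕ, ENNReal.ofReal ((1 / 4) ^ i) *
      (ENNReal.ofReal ((1 / 2) ^ i) * energy (ModPair (p ^ 2)) i (96 * (p : ℝ) ^ 4) +
        ENNReal.ofReal (2 ^ i) * energy (ModPair (p ^ 2)) 0 (96 * (p : ℝ) ^ 4)) ≤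
      ENNReal.ofReal (C * R * 8) := by
    have hgeom := (hasSum_geometric_of_lt_one (r := (3 / 4 : ℝ)) (by norm_num)
      (by norm_num)).mul_left (C * R * 2)
    have hs : ENNReal.ofReal (C * R * 8) = ∑' i : ℕ, ENNReal.ofReal (C * R * 2 * (3 / 4) ^ i) := by
      rw [← ENNReal.ofReal_tsum_of_nonneg (fun i => by positivity) hgeom.summable, hgeom.tsum_eq]
      congr 1
      norm_num
      ring
    rw [hs]
    refine ENNReal.tsum_le_tsum fun i => ?_
    refine (mul_le_mul_right (add_le_add (mul_le_mul_right (hE p i) _)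
      (mul_le_mul_right (hE p 0) _)) _).trans ?_
    rw [← ENNReal.ofReal_mul (by positivity), ← ENNReal.ofReal_mul (by positivity),
      ← ENNReal.ofReal_add (by positivity) (by positivity), ← ENNReal.ofReal_mul (by positivity)]
    refine ENNReal.ofReal_le_ofReal ?_
    have e1 : (1 / 4 : ℝ) ^ i * ((1 / 2) ^ i * 6 ^ i) = (3 / 4) ^ i := by
      rw [← mul_pow, ← mul_pow]; norm_num
    have e2 : (1 / 4 : ℝ) ^ i * 2 ^ i ≤ (3 / 4) ^ i := by
      rw [← mul_pow]; gcongr; norm_num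
    calc _ = C * R * ((1 / 4 : ℝ) ^ i * ((1 / 2) ^ i * 6 ^ i)) +
          C * R * ((1 / 4 : ℝ) ^ i * 2 ^ i) := by ring
      _ ≤ C * R * (3 / 4) ^ i + C * R * (3 / 4) ^ i := by rw [e1]; gcongr
      _ = _ := by ring
  have hfin := hlow.trans (hchain.trans (mul_le_mul_right hup _))
  rw [← ENNReal.ofReal_mul (by positivity)] at hfin
  have hne : ENNReal.ofReal ((p : ℝ) ^ 2) ≠ 0 := by
    rw [ne_eq, ENNReal.ofReal_eq_zero, not_le]; positivity
  refine (ENNReal.mul_le_mul_iff_right hne ENNReal.ofReal_ne_top).1 (hfin.trans (le_of_eq ?_))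
  rw [← ENNReal.ofReal_mul (by positivity)]
  congr 1
  have hpw : (p : ℝ) ^ (3 / 4 : ℝ) = (p : ℝ) ^ 2 * (p : ℝ) ^ (-(5 / 4) : ℝ) := by
    rw [← Real.rpow_natCast, ← Real.rpow_add hp0]
    norm_num
  rw [hR, hpw]
  field_simp

lemma frobNorm_le_iff (γ : SL2Z) {T : ℝ} (hT : 0 ≤ T) : frobNorm γ ≤ T ↔ frobSq γ ≤ T ^ 2 := by
  have h : ((γ 0 0 ^ 2 + γ 0 1 ^ 2 + γ 1 0 ^ 2 + γ 1 1 ^ 2 : ℤ) : ℝ) = frobSq γ := by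
    unfold frobSq qf
    push_cast
    ring
  unfold frobNorm
  rw [h, Real.sqrt_le_left hT]

/-- Bound for matrices whose trace is close to `2` modulo `p ^ 2`, when `p` is large. -/
lemma exists_count_le_of_le_pow : ∃ C : ℝ, 0 < C ∧ ∀ p : ℕ, p.Prime → ∀ T : ℝ, 1 ≤ T →
    T ≤ (p : ℝ) ^ 4 →
    ∑' γ : SL2Z, ind (frobSq γ ≤ T ^ 2 ∧ (p : ℤ) ^ 2 ∣ 2 - trZ γ ∧ 2 < |trZ γ|) ≤
      ENNReal.ofReal (C * T ^ 2 * (p : ℝ) ^ (-(5 / 4) : ℝ)) := by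
  obtain ⟨C, hC, hD⟩ := exists_tsum_diag_le
  refine ⟨64 * C, by positivity, fun p hp T hT hTp => ?_⟩
  have hp1 : (1 : ℝ) ≤ p := by exact_mod_cast hp.one_lt.le
  have hp0 : (0 : ℝ) < p := by linarith
  set g : ℤ → ℤ → ℝ≥0∞ := fun a d => ind ((p : ℤ) ^ 2 ∣ 2 - (a + d) ∧ 2 - (a + d) ≠ 0) with hg
  have hpz : (p : ℤ) ^ 2 ≠ 0 := pow_ne_zero _ (by exact_mod_cast hp.ne_zero)
  have hmult : ∑' t : ℤ, ind (|(t : ℝ)| ≤ 4 * T ∧ (p : ℤ) ^ 2 ∣ t ∧ t ≠ 0) ≤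
      ENNReal.ofReal (16 * T / p ^ 2) := by
    set x : ℝ := 4 * T / p ^ 2 with hx
    have hx0 : 0 ≤ x := by positivity
    calc _ = ∑' t : ℤ, ind (|(t : ℝ)| ≤ 4 * T ∧ (p : ℤ) ^ 2 ∣ t ∧ t ≠ 0) * 1 := by
          simp only [mul_one]
      _ ≤ ∑' s : ℤ, ind (|(s : ℝ)| ≤ x ∧ s ≠ 0) := by
          refine tsum_ind_le_of_injOn (fun t : ℤ => t / (p : ℤ) ^ 2) _ _ ?_ ?_
          · rintro s t ⟨-, h1, -⟩ ⟨-, h2, -⟩ h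
            exact (Int.ediv_left_inj h1 h2).1 h
          · rintro _ ⟨h1, ⟨s, rfl⟩, h0⟩
            rw [Int.mul_ediv_cancel_left _ hpz, ind_of]
            refine ⟨?_, right_ne_zero_of_mul h0⟩
            rw [hx, le_div_iff₀ (by positivity)]
            push_cast at h1
            rwa [abs_mul, abs_of_pos (by positivity : (0 : ℝ) < (p : ℝ) ^ 2), mul_comm] at h1
      _ ≤ ENNReal.ofReal (4 * x) := by
          by_cases hx1 : 1 ≤ x
          · calc _ ≤ ∑' s : ℤ, ind (|(s : ℝ)| ≤ x) :=
                  ENNReal.tsum_le_tsum fun s => ind_mono fun h => h.1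
              _ ≤ _ := tsum_int_abs_le hx0
              _ ≤ _ := ENNReal.ofReal_le_ofReal (by linarith)
          · have : ∀ s : ℤ, ind (|(s : ℝ)| ≤ x ∧ s ≠ 0) = 0 := fun s => ind_of_not fun h =>
              hx1 ((one_le_abs_cast h.2).trans h.1)
            simp [this]
      _ = _ := by rw [hx]; congr 1; ring
  calc _ ≤ ∑' γ : SL2Z, ind (γ 0 1 * γ 1 0 ≠ 0 ∧ |(γ 0 0 : ℝ)| ≤ T ∧ |(γ 1 1 : ℝ)| ≤ T) *
        g (γ 0 0) (γ 1 1) := by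
        refine ENNReal.tsum_le_tsum fun γ => ?_
        rw [hg, ind_mul_ind]
        refine ind_mono ?_
        rintro ⟨h1, h2, h3⟩
        unfold frobSq qf at h1
        unfold trZ at h2 h3
        have sa := sq_nonneg (γ 0 0 : ℝ)
        have sb := sq_nonneg (γ 0 1 : ℝ)
        have sc := sq_nonneg (γ 1 0 : ℝ)
        have sd := sq_nonneg (γ 1 1 : ℝ)
        refine ⟨⟨fun h0 => ?_, abs_le_of_sq_le_sq (by linarith) (by linarith),
          abs_le_of_sq_le_sq (by linarith) (by linarith)⟩, h2, fun h0 => ?_⟩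
        · have had : γ 0 0 * γ 1 1 = 1 := by linarith [γ.det_eq]
          rcases Int.eq_one_or_neg_one_of_mul_eq_one' had with ⟨h, h'⟩ | ⟨h, h'⟩ <;>
            norm_num [h, h'] at h3
        · rw [show γ 0 0 + γ 1 1 = 2 by linarith] at h3
          norm_num at h3
    _ ≤ _ := hD T hT g
    _ ≤ ENNReal.ofReal (C * T ^ (1 / 8 : ℝ)) *
        (ENNReal.ofReal (2 * T + 2) * ENNReal.ofReal (16 * T / p ^ 2)) := by
        gcongr
        calc _ ≤ ∑' a : ℤ, ind (|(a : ℝ)| ≤ T) * ENNReal.ofReal (16 * T / p ^ 2) := by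
              refine ENNReal.tsum_le_tsum fun a => ?_
              simp only [← ind_mul_ind (|(a : ℝ)| ≤ T), mul_assoc, ENNReal.tsum_mul_left]
              refine ind_mul_le_ind_mul fun ha => le_trans ?_ hmult
              rw [← (Equiv.subLeft (2 - a)).tsum_eq]
              refine ENNReal.tsum_le_tsum fun d => ?_
              rw [hg, ind_mul_ind, Equiv.subLeft_apply]
              refine ind_mono ?_
              rintro ⟨hd, h1, h2⟩
              rw [show 2 - (a + (2 - a - d)) = d by ring] at h1 h2
              refine ⟨?_, h1, h2⟩
              push_cast at hd
              rw [abs_le] at ha hd ⊢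
              constructor <;> linarith
          _ = (∑' a : ℤ, ind (|(a : ℝ)| ≤ T)) * ENNReal.ofReal (16 * T / p ^ 2) :=
              ENNReal.tsum_mul_right
          _ ≤ _ := by
              gcongr
              exact tsum_int_abs_le (by linarith)
    _ ≤ _ := by
        rw [← ENNReal.ofReal_mul (by positivity), ← ENNReal.ofReal_mul (by positivity)]
        refine ENNReal.ofReal_le_ofReal ?_
        have hpw : T ^ (1 / 8 : ℝ) / (p : ℝ) ^ 2 ≤ (p : ℝ) ^ (-(5 / 4) : ℝ) := by
          rw [div_le_iff₀ (by positivity)]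
          calc T ^ (1 / 8 : ℝ) ≤ ((p : ℝ) ^ 4) ^ (1 / 8 : ℝ) := by gcongr
            _ = (p : ℝ) ^ (1 / 2 : ℝ) := by
                rw [← Real.rpow_natCast, ← Real.rpow_mul hp0.le]
                norm_num
            _ ≤ (p : ℝ) ^ (3 / 4 : ℝ) :=
                Real.rpow_le_rpow_of_exponent_le hp1 (by norm_num)
            _ = _ := by
                rw [← Real.rpow_natCast, ← Real.rpow_add hp0]
                norm_num
        calc C * T ^ (1 / 8 : ℝ) * ((2 * T + 2) * (16 * T / p ^ 2)) =
              16 * C * T * (2 * T + 2) * (T ^ (1 / 8 : ℝ) / (p : ℝ) ^ 2) := by ring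
          _ ≤ 16 * C * T * (2 * T + 2 * T) * (p : ℝ) ^ (-(5 / 4) : ℝ) := by gcongr; linarith
          _ = _ := by ring

/-- Uniform bound for hyperbolic matrices whose trace is close to `2` modulo `p ^ 2`. -/
lemma exists_count_le : ∃ C : ℝ, 0 < C ∧ ∀ p : ℕ, p.Prime → ∀ T : ℝ, 1 ≤ T →
    ∑' γ : SL2Z, ind (frobSq γ ≤ T ^ 2 ∧ (p : ℤ) ^ 2 ∣ 2 - trZ γ ∧ 2 < |trZ γ|) ≤
      ENNReal.ofReal (C * T ^ 2 * (p : ℝ) ^ (-(5 / 4) : ℝ)) := by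
  obtain ⟨C₁, hC₁, h₁⟩ := exists_count_le_of_le_pow
  obtain ⟨C₂, hC₂, h₂⟩ := exists_count_le_of_pow_le
  refine ⟨C₁ + C₂, by positivity, fun p hp T hT => ?_⟩
  rcases le_total T ((p : ℝ) ^ 4) with h | h
  · refine (h₁ p hp T hT h).trans (ENNReal.ofReal_le_ofReal ?_)
    gcongr
    linarith
  · refine le_trans (ENNReal.tsum_le_tsum fun γ => ind_mono ?_)
      ((h₂ p hp T h).trans (ENNReal.ofReal_le_ofReal ?_))
    · exact fun h => ⟨h.1, h.2.1⟩
    · gcongr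
      linarith

lemma sq_dvd_of_inMK {K : ℕ} (hK : 3 ≤ K) {γ : SL2Z} (h : InMK K γ) :
    ∃ q : ℕ, K ≤ q ∧ q.Prime ∧ ((q : ℤ) ^ 2 ∣ 2 - trZ γ ∨ (q : ℤ) ^ 2 ∣ 2 + trZ γ) := by
  obtain ⟨-, m, D, -, -, -, hmD, q, hq, hKq, hqm⟩ := h
  refine ⟨q, hKq, hq, ?_⟩
  have hdvd : (q : ℤ) ^ 2 ∣ (2 - trZ γ) * (2 + trZ γ) := by
    rw [show (2 - trZ γ) * (2 + trZ γ) = -(m ^ 2 * D) by rw [← hmD]; ring, dvd_neg]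
    exact Dvd.dvd.mul_right (pow_dvd_pow_of_dvd hqm 2) _
  have hqp := Nat.prime_iff_prime_int.1 hq
  by_cases h1 : (q : ℤ) ∣ 2 - trZ γ
  · by_cases h2 : (q : ℤ) ∣ 2 + trZ γ
    · have h4 : (q : ℤ) ∣ 2 ^ 2 := by
        have := dvd_add h1 h2
        rwa [show 2 - trZ γ + (2 + trZ γ) = 2 ^ 2 by ring] at this
      have := Int.le_of_dvd (by norm_num) (hqp.dvd_of_dvd_pow h4)
      omega
    · exact Or.inl ((((hqp.coprime_iff_not_dvd.2 h2).pow_left)).dvd_of_dvd_mul_right hdvd)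
  · exact Or.inr ((((hqp.coprime_iff_not_dvd.2 h1).pow_left)).dvd_of_dvd_mul_left hdvd)

lemma exists_bad_count_le : ∃ C : ℝ, 0 < C ∧ ∀ K : ℕ, 3 ≤ K → ∀ T : ℝ, 1 ≤ T →
    ∑' γ : SL2Z, ind (frobNorm γ ≤ T ∧ InMK K γ) ≤
      ENNReal.ofReal (C * T ^ 2) *
        ∑' q : ℕ, ind (K ≤ q) * ENNReal.ofReal ((q : ℝ) ^ (-(5 / 4) : ℝ)) := by
  obtain ⟨C, hC, hcount⟩ := exists_count_le
  refine ⟨2 * C, by positivity, fun K hK T hT => ?_⟩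
  have hneg : ∀ q : ℕ,
      ∑' γ : SL2Z, ind (frobSq γ ≤ T ^ 2 ∧ (q : ℤ) ^ 2 ∣ 2 + trZ γ ∧ 2 < |trZ γ|) =
      ∑' γ : SL2Z, ind (frobSq γ ≤ T ^ 2 ∧ (q : ℤ) ^ 2 ∣ 2 - trZ γ ∧ 2 < |trZ γ|) := by
    intro q
    rw [← (Equiv.neg SL2Z).tsum_eq]
    refine tsum_congr fun γ => ?_
    have e1 : frobSq (-γ) = frobSq γ := by simp [frobSq, qf]
    have e2 : trZ (-γ) = -trZ γ := by simp [trZ]; ring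
    rw [Equiv.neg_apply, e1, e2, abs_neg, ← sub_eq_add_neg]
  calc _ ≤ ∑' γ : SL2Z, ∑' q : ℕ, ind (K ≤ q ∧ q.Prime) *
        (ind (frobSq γ ≤ T ^ 2 ∧ (q : ℤ) ^ 2 ∣ 2 - trZ γ ∧ 2 < |trZ γ|) +
          ind (frobSq γ ≤ T ^ 2 ∧ (q : ℤ) ^ 2 ∣ 2 + trZ γ ∧ 2 < |trZ γ|)) := by
        refine ENNReal.tsum_le_tsum fun γ => ?_
        by_cases h : frobNorm γ ≤ T ∧ InMK K γ
        swap
        · rw [ind_of_not h]; exact zero_le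
        obtain ⟨q, hKq, hq, hdvd⟩ := sq_dvd_of_inMK hK h.2
        have hF := (frobNorm_le_iff γ (by linarith)).1 h.1
        refine (ind_le_one _).trans (le_trans ?_ (ENNReal.le_tsum q))
        rw [ind_of ⟨hKq, hq⟩, one_mul]
        rcases hdvd with hd | hd
        · exact le_add_right (ind_of ⟨hF, hd, h.2.1⟩).ge
        · exact le_add_left (ind_of ⟨hF, hd, h.2.1⟩).ge
    _ = ∑' q : ℕ, ind (K ≤ q ∧ q.Prime) *
        (2 * ∑' γ : SL2Z, ind (frobSq γ ≤ T ^ 2 ∧ (q : ℤ) ^ 2 ∣ 2 - trZ γ ∧ 2 < |trZ γ|)) := by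
        rw [ENNReal.tsum_comm]
        refine tsum_congr fun q => ?_
        rw [ENNReal.tsum_mul_left, ENNReal.tsum_add, hneg, two_mul]
    _ ≤ ∑' q : ℕ, ENNReal.ofReal (2 * C * T ^ 2) *
        (ind (K ≤ q) * ENNReal.ofReal ((q : ℝ) ^ (-(5 / 4) : ℝ))) := by
        refine ENNReal.tsum_le_tsum fun q => ?_
        by_cases hq : K ≤ q ∧ q.Prime
        swap
        · rw [ind_of_not hq, zero_mul]; exact zero_le
        rw [ind_of hq, ind_of hq.1, one_mul, one_mul, ← ENNReal.ofReal_mul (by positivity)]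
        calc _ ≤ 2 * ENNReal.ofReal (C * T ^ 2 * (q : ℝ) ^ (-(5 / 4) : ℝ)) := by
              gcongr
              exact hcount q hq.2 T hT
          _ = _ := by
              rw [← ENNReal.ofReal_ofNat, ← ENNReal.ofReal_mul (by norm_num)]
              congr 1
              ring
    _ = _ := ENNReal.tsum_mul_left

lemma exists_bottom_row {c d : ℕ} (hc : 0 < c) (hd : 0 < d) (hcd : c.Coprime d) :
    ∃ γ : SL2Z, γ 1 0 = c ∧ γ 1 1 = d ∧ |γ 0 0| ≤ c ∧ |γ 0 1| ≤ d := by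
  have hc' : (0 : ℤ) < c := by exact_mod_cast hc
  have hd' : (0 : ℤ) < d := by exact_mod_cast hd
  obtain ⟨u, v, huv⟩ := Nat.isCoprime_iff_coprime.2 hcd
  set a : ℤ := v % c with ha
  set b : ℤ := -(u + v / c * d) with hb
  have hv : v = a + c * (v / c) := (Int.emod_add_mul_ediv v c).symm
  have hdet : a * d - b * c = 1 := by
    rw [hb]
    linear_combination huv - d * hv
  have ha0 : 0 ≤ a := Int.emod_nonneg _ hc'.ne'
  have hac : a < c := Int.emod_lt_of_pos _ hc'
  refine ⟨⟨!![a, b; c, d], by rw [Matrix.det_fin_two_of, hdet]⟩, rfl, rfl, ?_, ?_⟩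
  · change |a| ≤ c
    rw [abs_of_nonneg ha0]
    exact hac.le
  · change |b| ≤ d
    rw [abs_le]
    constructor <;> by_contra h <;> nlinarith

lemma card_coprime_pairs_ge (N : ℕ) : (N : ℝ) ^ 2 / 4 ≤
    ((Finset.Ioc 0 N ×ˢ Finset.Ioc 0 N).filter fun v => v.1.Coprime v.2).card := by
  classical
  set S := Finset.Ioc 0 N ×ˢ Finset.Ioc 0 N with hS
  have hcardS : S.card = N ^ 2 := by simp [hS, sq]
  have hnot : (S.filter fun v => ¬v.1.Coprime v.2) ⊆ (Finset.Ioc 1 N).biUnion fun g =>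
      (Finset.Ioc 0 N).filter (g ∣ ·) ×ˢ (Finset.Ioc 0 N).filter (g ∣ ·) := by
    rintro ⟨c, d⟩ hv
    simp only [hS, Finset.mem_filter, Finset.mem_product, Finset.mem_Ioc,
      Finset.mem_biUnion] at hv ⊢
    obtain ⟨⟨⟨hc0, hcN⟩, hd0, hdN⟩, hcop⟩ := hv
    have hg := Nat.gcd_pos_of_pos_left d hc0
    have hgc := Nat.le_of_dvd hc0 (Nat.gcd_dvd_left c d)
    have hg1 : Nat.gcd c d ≠ 1 := hcop
    exact ⟨Nat.gcd c d, ⟨by omega, by omega⟩, ⟨⟨hc0, hcN⟩, Nat.gcd_dvd_left c d⟩,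
      ⟨hd0, hdN⟩, Nat.gcd_dvd_right c d⟩
  have h1 : ((S.filter fun v => ¬v.1.Coprime v.2).card : ℝ) ≤
      ∑ g ∈ Finset.Ioc 1 N, (N : ℝ) ^ 2 * ((g : ℝ) ^ 2)⁻¹ := by
    calc ((S.filter fun v => ¬v.1.Coprime v.2).card : ℝ) ≤
          ((∑ g ∈ Finset.Ioc 1 N, (N / g) * (N / g) : ℕ) : ℝ) := by
          refine Nat.cast_le.2 ((Finset.card_le_card hnot).trans
            (Finset.card_biUnion_le.trans (Finset.sum_le_sum fun g _ => ?_)))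
          rw [Finset.card_product, Nat.Ioc_filter_dvd_card_eq_div]
      _ ≤ _ := by
          push_cast
          refine Finset.sum_le_sum fun g _ => ?_
          have : ((N / g : ℕ) : ℝ) ≤ N / g := Nat.cast_div_le
          calc ((N / g : ℕ) : ℝ) * ((N / g : ℕ) : ℝ) ≤ (N / g : ℝ) * (N / g) := by gcongr
            _ = _ := by rw [← sq, div_pow, div_eq_mul_inv]
  have h2 : ∑ g ∈ Finset.Ioc 1 N, ((g : ℝ) ^ 2)⁻¹ ≤ 3 / 4 := by
    rcases le_or_gt N 1 with h | h
    · rw [Finset.Ioc_eq_empty (by omega)]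
      norm_num
    · rw [← Finset.sum_Ioc_consecutive _ (show 1 ≤ 2 by norm_num) h]
      have h3 := sum_Ioc_inv_sq_le_sub (α := ℝ) (k := 2) (n := N) (by norm_num) h
      have h4 : (0 : ℝ) ≤ (N : ℝ)⁻¹ := by positivity
      have h5 : Finset.Ioc 1 2 = {2} := rfl
      rw [h5, Finset.sum_singleton]
      norm_num at h3 ⊢
      linarith
  have h3 := Finset.card_filter_add_card_filter_not (s := S) (fun v : ℕ × ℕ => v.1.Coprime v.2)
  rw [hcardS] at h3
  have h3' : ((S.filter fun v => v.1.Coprime v.2).card : ℝ) +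
      (S.filter fun v => ¬v.1.Coprime v.2).card = (N : ℝ) ^ 2 := by exact_mod_cast h3
  rw [← Finset.mul_sum] at h1
  nlinarith [sq_nonneg (N : ℝ)]

lemma count_ge {T : ℝ} (hT : 4 ≤ T) :
    ENNReal.ofReal (T ^ 2 / 64) ≤ ∑' γ : SL2Z, ind (frobNorm γ ≤ T) := by
  set N := ⌊T / 2⌋₊ with hN
  have hNT : (N : ℝ) ≤ T / 2 := Nat.floor_le (by linarith)
  have hNT' : T / 4 ≤ N := by
    have := Nat.lt_floor_add_one (T / 2)
    linarith
  set S := (Finset.Ioc 0 N ×ˢ Finset.Ioc 0 N).filter fun v : ℕ × ℕ => v.1.Coprime v.2 with hS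
  have hmem : ∀ v : S, ∃ γ : SL2Z, γ 1 0 = (v : ℕ × ℕ).1 ∧ γ 1 1 = (v : ℕ × ℕ).2 ∧
      frobNorm γ ≤ T := by
    rintro ⟨⟨c, d⟩, hv⟩
    simp only [hS, Finset.mem_filter, Finset.mem_product, Finset.mem_Ioc] at hv
    obtain ⟨⟨⟨hc0, hcN⟩, hd0, hdN⟩, hcop⟩ := hv
    obtain ⟨γ, h10, h11, h00, h01⟩ := exists_bottom_row hc0 hd0 hcop
    refine ⟨γ, h10, h11, (frobNorm_le_iff γ (by linarith)).2 ?_⟩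
    have hc : (c : ℝ) ≤ T / 2 := le_trans (by exact_mod_cast hcN) hNT
    have hd : (d : ℝ) ≤ T / 2 := le_trans (by exact_mod_cast hdN) hNT
    have ha : |(γ 0 0 : ℝ)| ≤ c := by exact_mod_cast h00
    have hb : |(γ 0 1 : ℝ)| ≤ d := by exact_mod_cast h01
    have hc0' : (0 : ℝ) ≤ c := Nat.cast_nonneg _
    have hd0' : (0 : ℝ) ≤ d := Nat.cast_nonneg _
    have hbound : ∀ x : ℝ, |x| ≤ T / 2 → x ^ 2 ≤ T ^ 2 / 4 := by
      intro x hx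
      have := sq_le_sq' (abs_le.1 hx).1 (abs_le.1 hx).2
      linarith
    unfold frobSq qf
    rw [h10, h11]
    push_cast
    have e1 := hbound _ (ha.trans hc)
    have e2 := hbound _ (hb.trans hd)
    have e3 := hbound c (by rwa [abs_of_nonneg hc0'])
    have e4 := hbound d (by rwa [abs_of_nonneg hd0'])
    linarith
  choose f hf0 hf1 hfT using hmem
  have hinj : Function.Injective f := by
    intro v w h
    have e0 := hf0 v
    have e1 := hf1 v
    rw [h] at e0 e1
    exact Subtype.ext (Prod.ext (by exact_mod_cast e0.symm.trans (hf0 w))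
      (by exact_mod_cast e1.symm.trans (hf1 w)))
  calc ENNReal.ofReal (T ^ 2 / 64) ≤ ENNReal.ofReal (S.card : ℝ) := by
        refine ENNReal.ofReal_le_ofReal (le_trans ?_ (card_coprime_pairs_ge N))
        nlinarith
    _ = ∑' v : S, ind (frobNorm (f v) ≤ T) := by
        rw [tsum_congr fun v => ind_of (hfT v)]
        simp
    _ ≤ _ := ENNReal.tsum_comp_le_tsum_of_injective hinj fun γ => ind (frobNorm γ ≤ T)

lemma tsum_ind_eq_natCard {α : Type*} (P : α → Prop) [Finite {a // P a}] :
    ∑' a, ind (P a) = (Nat.card {a // P a} : ℝ≥0∞) := by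
  classical
  have := Fintype.ofFinite {a // P a}
  have h1 : ∑' a : {a // P a}, ind (P a) = ∑' a, ind (P a) :=
    tsum_subtype_eq_of_support_subset (s := {a | P a}) (f := fun a => ind (P a)) fun a ha => by
      by_contra hP
      exact ha (ind_of_not hP)
  rw [← h1, tsum_congr fun a : {a // P a} => ind_of a.2, Nat.card_eq_fintype_card]
  simp

lemma exists_tail_le {δ : ℝ} (hδ : 0 < δ) : ∃ K : ℕ, 3 ≤ K ∧
    ∑' q : ℕ, ind (K ≤ q) * ENNReal.ofReal ((q : ℝ) ^ (-(5 / 4) : ℝ)) ≤ ENNReal.ofReal δ := by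
  have hsum : Summable fun q : ℕ => (q : ℝ) ^ (-(5 / 4) : ℝ) :=
    Real.summable_nat_rpow.2 (by norm_num)
  have htail := ENNReal.tendsto_sum_nat_add _ hsum.tsum_ofReal_ne_top
  obtain ⟨K, hK, hK3⟩ := ((htail.eventually (ge_mem_nhds (ENNReal.ofReal_pos.2 hδ))).and
    (eventually_ge_atTop 3)).exists
  refine ⟨K, hK3, le_trans ?_ hK⟩
  refine tsum_ind_le_of_injOn (fun q => q - K) _ _ ?_ ?_
  · intro x y hx hy h
    omega
  · intro q hq
    rw [Nat.sub_add_cancel hq]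

lemma natCard_ratio_le {B c T : ℝ} {P Q : SL2Z → Prop} (hB : 0 ≤ B) (hc : 0 < c) (hT : 0 < T)
    (hQ : ∑' γ, ind (P γ ∧ Q γ) ≤ ENNReal.ofReal (B * T ^ 2))
    (hP : ENNReal.ofReal (c * T ^ 2) ≤ ∑' γ, ind (P γ)) :
    (Nat.card {γ // P γ ∧ Q γ} : ℝ) / (Nat.card {γ // P γ} : ℝ) ≤ B / c := by
  by_cases hfin : Finite {γ // P γ}
  swap
  · have := not_finite_iff_infinite.1 hfin
    rw [Nat.card_eq_zero_of_infinite (α := {γ // P γ}), Nat.cast_zero, div_zero]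
    positivity
  have : Finite {γ // P γ ∧ Q γ} :=
    Finite.of_injective (fun γ => (⟨γ.1, γ.2.1⟩ : {γ // P γ})) fun x y h =>
      Subtype.ext (congrArg (fun z : {γ // P γ} => z.1) h)
  rw [tsum_ind_eq_natCard, ← ENNReal.ofReal_natCast] at hP hQ
  have hQ' := (ENNReal.ofReal_le_ofReal_iff (by positivity)).1 hQ
  have hP' := (ENNReal.ofReal_le_ofReal_iff (by positivity)).1 hP
  have hpos : (0 : ℝ) < Nat.card {γ // P γ} := lt_of_lt_of_le (by positivity) hP'
  rw [div_le_div_iff₀ hpos hc]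
  calc _ ≤ B * T ^ 2 * c := by gcongr
    _ = B * (c * T ^ 2) := by ring
    _ ≤ _ := by gcongr

/-- For every `ε > 0` there is `K(ε) > 0` such that the upper density (w.r.t. `ℙ_T`)
of the set of hyperbolic `γ` for which some prime `p ≥ K(ε)` divides `m_γ` is at most
`ε`. -/
theorem statement19 (ε : ℝ) (hε : 0 < ε) :
    ∃ K : ℕ, 0 < K ∧
      Filter.limsup (fun T : ℝ =>
          (Nat.card {γ : SL2Z // frobNorm γ ≤ T ∧ InMK K γ} : ℝ) /
            (Nat.card {γ : SL2Z // frobNorm γ ≤ T} : ℝ))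
        atTop ≤ ε := by
  obtain ⟨C, hC, hbad⟩ := exists_bad_count_le
  obtain ⟨K, hK, htail⟩ := exists_tail_le (δ := ε / (64 * C)) (by positivity)
  refine ⟨K, by omega, Filter.limsup_le_of_le ?_ ?_⟩
  · exact Filter.isCoboundedUnder_le_of_le atTop (x := 0) fun T => by positivity
  filter_upwards [eventually_ge_atTop (4 : ℝ)] with T hT
  have hQ : ∑' γ : SL2Z, ind (frobNorm γ ≤ T ∧ InMK K γ) ≤
      ENNReal.ofReal (ε / 64 * T ^ 2) := by
    refine (hbad K hK T (by linarith)).trans ((mul_le_mul_right htail _).trans ?_)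
    rw [← ENNReal.ofReal_mul (by positivity)]
    refine ENNReal.ofReal_le_ofReal (le_of_eq ?_)
    field_simp
  have hP : ENNReal.ofReal (1 / 64 * T ^ 2) ≤ ∑' γ : SL2Z, ind (frobNorm γ ≤ T) := by
    refine le_trans (ENNReal.ofReal_le_ofReal (le_of_eq ?_)) (count_ge hT)
    ring
  refine (natCard_ratio_le (by positivity) (by norm_num) (by linarith) hQ hP).trans (le_of_eq ?_)
  ring
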